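/- arXiv:1111.4475 — 3 statements merged into one kernel-verified Lean document; each statement's English description precedes it below -/
import Mathlib

section
/- Let n ≥ 1 and let a_1, …, a_n : ℝ → ℂ be continuous functions. Then there exist continuous functions λ_1, …, λ_n : ℝ → ℂ such that for every t ∈ ℝ the polynomial identity z^n + ∑_{j=1}^n (−1)^j a_j(t) z^{n−j} = ∏_{j=1}^n (z − λ_j(t)) holds in ℂ[z]; i.e., the roots of a monic polynomial whose coefficients depend continuously on a real parameter admit a continuous parameterization. -/
open Polynomial

/-- The monic polynomial `z^n + ∑_{j=1}^n (-1)^j a_j z^{n-j}`, where `a j` (for `j : Fin n`)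
corresponds to the coefficient `a_{j+1}`. -/
noncomputable def monicPoly (n : ℕ) (a : Fin n → ℂ) : Polynomial ℂ :=
  X ^ n + ∑ j : Fin n, C ((-1 : ℂ) ^ ((j : ℕ) + 1) * a j) * X ^ (n - ((j : ℕ) + 1))

open Filter Topology

lemma disc_ivt (r : ℕ → ℝ) (η v : ℝ) (hη : 0 < η) (h0 : r 0 ≤ v) (b : ℕ)
    (hs : ∀ k < b, r (k+1) < r k + η) (hv : v ≤ r b) : ∃ k ≤ b, v ≤ r k ∧ r k < v + η := by
  induction b with
  | zero => exact ⟨0, le_rfl, hv, by linarith⟩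
  | succ b ih =>
    by_cases h : v ≤ r b
    · obtain ⟨k, hk, h1⟩ := ih (fun k hk => hs k (by omega)) h
      exact ⟨k, by omega, h1⟩
    · exact ⟨b+1, le_rfl, hv, by have := hs b (by omega); linarith [not_le.1 h]⟩

lemma chain_bound (n : ℕ) (c : Fin n → ℂ) (u : ℕ → ℂ) (ε : ℝ) (hε : 0 < ε) (b : ℕ)
    (hs : ∀ k < b, dist (u (k+1)) (u k) < 2 * ε)
    (hc : ∀ k ≤ b, ∃ i, dist (u k) (c i) < ε) : dist (u b) (u 0) < 4 * n * ε + ε := by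
  by_contra! hcon
  have key : ∀ m : Fin (n+1), ∃ i : Fin n, ∃ k, 4 * (m:ℕ) * ε ≤ dist (u k) (u 0) ∧
      dist (u k) (u 0) < 4 * (m:ℕ) * ε + 2 * ε ∧ dist (u k) (c i) < ε := by
    intro m
    obtain ⟨k, hk, h1, h2⟩ := disc_ivt (fun k => dist (u k) (u 0)) (2*ε) (4 * (m:ℕ) * ε)
      (by positivity) (by simp; positivity) b (fun k hk => by
        have := hs k hk
        have := dist_triangle (u (k+1)) (u k) (u 0)
        linarith) (by
        have : ((m:ℕ):ℝ) ≤ n := by exact_mod_cast Nat.lt_succ_iff.1 m.2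
        have : 4 * ((m:ℕ):ℝ) * ε ≤ 4 * n * ε := by gcongr
        linarith)
    obtain ⟨i, hi⟩ := hc k hk
    exact ⟨i, k, h1, h2, hi⟩
  choose f k h1 h2 h3 using key
  have aux : ∀ m m' : Fin (n+1), m < m' → f m ≠ f m' := by
    intro m m' hlt he
    have a1 := h3 m
    have a2 := h3 m'
    rw [← he] at a2
    have a3 := dist_triangle_right (u (k m')) (u (k m)) (c (f m))
    have a4 := dist_triangle (u (k m')) (u (k m)) (u 0)
    have a5 := h1 m'
    have a6 := h2 m
    have : ((m:ℕ):ℝ) + 1 ≤ (m':ℕ) := by exact_mod_cast hlt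
    have : 4 * (((m:ℕ):ℝ)+1) * ε ≤ 4 * (m':ℕ) * ε := by gcongr
    linarith
  have hinj : Function.Injective f := by
    intro m m' he
    rcases lt_trichotomy m m' with h | h | h
    · exact absurd he (aux _ _ h)
    · exact h
    · exact absurd he.symm (aux _ _ h)
  have := Fintype.card_le_of_injective f hinj
  simp at this

lemma local_match (n : ℕ) (E : (Fin n → ℂ) → (Fin n → ℂ)) (hE : Continuous E)
    (hEp : ∀ x y, E x = E y → ∃ σ : Equiv.Perm (Fin n), y ∘ σ = x)
    (p : ℝ → (Fin n → ℂ)) (hp : Continuous p)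
    (B : ℝ → ℝ) (hB : Continuous B) (hb : ∀ t y, E y = p t → ‖y‖ ≤ B t)
    (t₀ : ℝ) (x₀ : Fin n → ℂ) (hx₀ : E x₀ = p t₀) (ε : ℝ) (hε : 0 < ε) :
    ∃ δ > 0, ∀ t, dist t t₀ < δ → ∀ y, E y = p t →
      ∃ σ : Equiv.Perm (Fin n), dist (y ∘ σ) x₀ < ε := by
  obtain ⟨R, hR⟩ := (isCompact_closedBall t₀ 1).bddAbove_image (f := B) hB.continuousOn
  let K : Set (ℝ × (Fin n → ℂ)) := (Metric.closedBall t₀ 1 ×ˢ Metric.closedBall 0 R) ∩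
    ({q | E q.2 = p q.1} ∩ ⋂ σ : Equiv.Perm (Fin n), {q | ε ≤ dist (q.2 ∘ σ) x₀})
  have hK : IsCompact K := by
    refine IsCompact.inter_right ((isCompact_closedBall _ _).prod (isCompact_closedBall _ _)) ?_
    refine IsClosed.inter (isClosed_eq (by fun_prop) (by fun_prop)) ?_
    refine isClosed_iInter fun σ => isClosed_le continuous_const ?_
    refine Continuous.dist ?_ continuous_const
    refine continuous_pi fun i => ?_
    simp only [Function.comp]
    fun_prop
  have hK1 : IsClosed (Prod.fst '' K) := (hK.image continuous_fst).isClosed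
  have h0 : t₀ ∈ (Prod.fst '' K)ᶜ := by
    rintro ⟨⟨t, y⟩, ⟨_, h1, h2⟩, rfl⟩
    obtain ⟨σ, hσ⟩ := hEp x₀ y (hx₀.trans h1.symm)
    have := Set.mem_iInter.1 h2 σ
    simp only [Set.mem_ofPred_eq, hσ, dist_self] at this
    linarith
  obtain ⟨δ, hδ, hball⟩ := Metric.isOpen_iff.1 hK1.isOpen_compl _ h0
  refine ⟨min δ 1, by positivity, fun t ht y hy => ?_⟩
  by_contra! hcon
  refine hball (Metric.mem_ball.2 (lt_of_lt_of_le ht (min_le_left _ _))) ⟨(t, y), ?_, rfl⟩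
  have ht1 : t ∈ Metric.closedBall t₀ 1 :=
    Metric.mem_closedBall.2 (ht.le.trans (min_le_right _ _))
  refine ⟨⟨ht1, ?_⟩, hy, Set.mem_iInter.2 fun σ => hcon σ⟩
  simp only [mem_closedBall_zero_iff]
  exact (hb t y hy).trans (hR ⟨t, ht1, rfl⟩)

lemma grid_exists (n : ℕ) (E : (Fin n → ℂ) → (Fin n → ℂ))
    (hEi : ∀ y (σ : Equiv.Perm (Fin n)), E (y ∘ σ) = E y)
    (p : ℝ → (Fin n → ℂ)) (hsurj : ∀ t, ∃ y, E y = p t) (τ : ℕ → ℝ) :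
    ∃ z : ℕ → Fin n → ℂ, (∀ k, E (z k) = p (τ k)) ∧
      ∀ k (σ : Equiv.Perm (Fin n)), dist (z (k+1)) (z k) ≤ dist (z (k+1) ∘ σ) (z k) := by
  have step : ∀ (k : ℕ) (w : Fin n → ℂ), ∃ y, E y = p (τ k) ∧
      ∀ σ : Equiv.Perm (Fin n), dist y w ≤ dist (y ∘ σ) w := by
    intro k w
    obtain ⟨y, hy⟩ := hsurj (τ k)
    obtain ⟨σ, hσ⟩ := Finite.exists_min (fun σ : Equiv.Perm (Fin n) => dist (y ∘ σ) w)
    refine ⟨y ∘ σ, (hEi _ _).trans hy, fun ρ => ?_⟩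
    exact hσ (σ * ρ)
  choose f hf1 hf2 using step
  refine ⟨fun k => Nat.rec (f 0 0) (fun k w => f (k+1) w) k, fun k => ?_, fun k σ => ?_⟩
  · cases k <;> exact hf1 _ _
  · exact hf2 (k+1) _ σ

lemma abstract_main (n : ℕ) (E : (Fin n → ℂ) → (Fin n → ℂ)) (hE : Continuous E)
    (hEp : ∀ x y, E x = E y → ∃ σ : Equiv.Perm (Fin n), y ∘ σ = x)
    (hEi : ∀ y (σ : Equiv.Perm (Fin n)), E (y ∘ σ) = E y)
    (p : ℝ → (Fin n → ℂ)) (hp : Continuous p) (hsurj : ∀ t, ∃ y, E y = p t)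
    (B : ℝ → ℝ) (hB : Continuous B) (hb : ∀ t y, E y = p t → ‖y‖ ≤ B t) :
    ∃ l : ℝ → Fin n → ℂ, Continuous l ∧ ∀ t, E (l t) = p t := by
  let τ : ℕ → ℕ → ℝ := fun N k => -(N:ℝ) + k / ((N:ℝ)+1)
  have hτmono : ∀ N, Monotone (τ N) := by
    intro N k k' h
    have : (k:ℝ) ≤ k' := by exact_mod_cast h
    simp only [τ]
    gcongr
  let κ : ℝ → ℕ → ℕ := fun t N => ⌊(t + N) * ((N:ℝ)+1)⌋₊
  have hlim : ∀ t, Tendsto (fun N => τ N (κ t N)) atTop (𝓝 t) := by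
    intro t
    have hl : Tendsto (fun N : ℕ => t - 1 / ((N:ℝ)+1)) atTop (𝓝 t) := by
      simpa using tendsto_const_nhds.sub (tendsto_one_div_add_atTop_nhds_zero_nat (𝕜 := ℝ))
    have hev : ∀ᶠ N : ℕ in atTop, -t ≤ (N:ℝ) :=
      tendsto_natCast_atTop_atTop.eventually_ge_atTop (-t)
    refine tendsto_of_tendsto_of_tendsto_of_le_of_le' hl tendsto_const_nhds ?_ ?_
    · filter_upwards with N
      have hN : (0:ℝ) < (N:ℝ) + 1 := by positivity
      have := Nat.lt_floor_add_one ((t + N) * ((N:ℝ)+1))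
      have h2 : (t + N) < ((κ t N : ℝ) + 1) / ((N:ℝ)+1) := by
        rw [lt_div_iff₀ hN]; exact this
      rw [add_div] at h2
      simp only [τ]; linarith
    · filter_upwards [hev] with N h
      have hN : (0:ℝ) < (N:ℝ) + 1 := by positivity
      have := Nat.floor_le (a := (t + N) * ((N:ℝ)+1)) (mul_nonneg (by linarith) hN.le)
      have h2 : (κ t N : ℝ) / ((N:ℝ)+1) ≤ t + N := by
        rw [div_le_iff₀ hN]; exact this
      simp only [τ]; linarith
  have hz := fun N => grid_exists n E hEi p hsurj (τ N)
  choose z hz1 hz2 using hz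
  let U : Ultrafilter ℕ := hyperfilter ℕ
  have hU : (U : Filter ℕ) ≤ atTop := Nat.hyperfilter_le_atTop
  have hex : ∀ t, ∃ x, Tendsto (fun N => z N (κ t N)) U (𝓝 x) := by
    intro t
    have h1 : ∀ᶠ N in (U : Filter ℕ), z N (κ t N) ∈ Metric.closedBall (0 : Fin n → ℂ) (B t + 1) := by
      have : ∀ᶠ N in atTop, B (τ N (κ t N)) < B t + 1 :=
        ((hB.tendsto t).comp (hlim t)).eventually_lt_const (by linarith)
      filter_upwards [hU this] with N hN
      rw [mem_closedBall_zero_iff]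
      exact (hb _ _ (hz1 N _)).trans hN.le
    obtain ⟨x, -, hx⟩ := (isCompact_closedBall (0 : Fin n → ℂ) (B t + 1)).ultrafilter_le_nhds
      (U.map fun N => z N (κ t N)) (le_principal_iff.2 h1)
    exact ⟨x, hx⟩
  choose l hl using hex
  have hroot : ∀ t, E (l t) = p t := by
    intro t
    have h1 : Tendsto (fun N => E (z N (κ t N))) U (𝓝 (E (l t))) := (hE.tendsto _).comp (hl t)
    have h2 : Tendsto (fun N => E (z N (κ t N))) U (𝓝 (p t)) := by
      simp only [hz1]
      exact ((hp.tendsto t).comp (hlim t)).mono_left hU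
    exact tendsto_nhds_unique h1 h2
  refine ⟨l, ?_, hroot⟩
  rw [continuous_iff_continuousAt]
  intro t₀
  rw [Metric.continuousAt_iff]
  intro ε' hε'
  obtain ⟨ε, hε, hεε⟩ : ∃ ε > 0, 4 * n * ε + ε < ε' := by
    refine ⟨ε' / (2 * (4 * n + 1)), by positivity, ?_⟩
    have : 4 * (n:ℝ) * (ε' / (2 * (4 * n + 1))) + ε' / (2 * (4 * n + 1)) = ε' / 2 := by
      field_simp
    linarith
  obtain ⟨δ, hδ, hm⟩ := local_match n E hE hEp p hp B hB hb t₀ (l t₀) (hroot t₀) ε hε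
  have seg : ∀ N k k', k ≤ k' → dist (τ N k) t₀ < δ → dist (τ N k') t₀ < δ →
      dist (z N k') (z N k) ≤ 4 * n * ε + ε := by
    intro N k k' hkk h1 h2
    obtain ⟨b, rfl⟩ := Nat.exists_eq_add_of_le hkk
    have hin : ∀ i ≤ b, dist (τ N (k + i)) t₀ < δ := by
      intro i hi
      have m1 := hτmono N (show k ≤ k + i by omega)
      have m2 := hτmono N (show k + i ≤ k + b by omega)
      rw [Real.dist_eq, abs_lt] at *
      constructor <;> linarith
    have hmi : ∀ i ≤ b, ∃ σ : Equiv.Perm (Fin n), dist (z N (k+i) ∘ σ) (l t₀) < ε :=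
      fun i hi => hm _ (hin i hi) _ (hz1 N _)
    have hstep : ∀ i < b, dist (z N (k+(i+1))) (z N (k+i)) < 2 * ε := by
      intro i hi
      obtain ⟨σ, hσ⟩ := hmi i hi.le
      obtain ⟨ρ, hρ⟩ := hmi (i+1) hi
      have h3 := hz2 N (k+i) (ρ * σ⁻¹)
      refine lt_of_le_of_lt h3 ?_
      rw [dist_pi_lt_iff (by positivity)]
      intro j
      have e1 := (dist_pi_lt_iff hε).1 hσ (σ⁻¹ j)
      have e2 := (dist_pi_lt_iff hε).1 hρ (σ⁻¹ j)
      simp only [Function.comp, Equiv.Perm.mul_apply] at e1 e2 ⊢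
      rw [show σ (σ⁻¹ j) = j by simp] at e1
      have := dist_triangle_right (z N (k+i+1) (ρ (σ⁻¹ j))) (z N (k+i) j) (l t₀ (σ⁻¹ j))
      have e2' : dist (z N (k+i+1) (ρ (σ⁻¹ j))) (l t₀ (σ⁻¹ j)) < ε := e2
      linarith
    rw [dist_pi_le_iff (by positivity)]
    intro j
    refine (chain_bound n (l t₀) (fun i => z N (k+i) j) ε hε b ?_ ?_).le
    · intro i hi
      exact lt_of_le_of_lt (dist_le_pi_dist _ _ j) (hstep i hi)
    · intro i hi
      obtain ⟨σ, hσ⟩ := hmi i hi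
      refine ⟨σ⁻¹ j, ?_⟩
      have := (dist_pi_lt_iff hε).1 hσ (σ⁻¹ j)
      simpa using this
  refine ⟨δ, hδ, fun {t} ht => lt_of_le_of_lt ?_ hεε⟩
  refine le_of_tendsto ((hl t).dist (hl t₀)) ?_
  have e1 : ∀ᶠ N in atTop, dist (τ N (κ t N)) t₀ < δ :=
    ((hlim t).dist tendsto_const_nhds).eventually_lt_const ht
  have e2 : ∀ᶠ N in atTop, dist (τ N (κ t₀ N)) t₀ < δ :=
    ((hlim t₀).dist tendsto_const_nhds).eventually_lt_const (by simpa using hδ)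
  filter_upwards [hU e1, hU e2] with N a1 a2
  rcases le_total (κ t N) (κ t₀ N) with h | h
  · rw [dist_comm]; exact seg N _ _ h a1 a2
  · exact seg N _ _ h a2 a1

lemma perm_of_prod_eq (n : ℕ) (x y : Fin n → ℂ)
    (h : ∏ j, (X - C (x j)) = ∏ j, (X - C (y j))) :
    ∃ σ : Equiv.Perm (Fin n), y ∘ σ = x := by
  classical
  have hr : ∀ w : Fin n → ℂ, (∏ j, (X - C (w j))).roots = Finset.univ.val.map w := by
    intro w
    have := roots_multiset_prod_X_sub_C (Finset.univ.val.map w)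
    rw [Multiset.map_map] at this
    exact this
  have hm : Finset.univ.val.map x = Finset.univ.val.map y := by rw [← hr, ← hr, h]
  have hc : ∀ c, Nonempty ({i // x i = c} ≃ {i // y i = c}) := by
    intro c
    refine ⟨Fintype.equivOfCardEq ?_⟩
    have := congrArg (Multiset.count c) hm
    rw [Multiset.count_map, Multiset.count_map] at this
    rw [Fintype.card_subtype, Fintype.card_subtype]
    simp only [Finset.card_def, Finset.filter_val]
    simpa only [eq_comm] using this
  exact ⟨Equiv.ofFiberEquiv fun c => (hc c).some, funext fun i => Equiv.ofFiberEquiv_map _ i⟩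

lemma monicPoly_deg_aux (n : ℕ) (a : Fin n → ℂ) :
    (∑ j : Fin n, C ((-1 : ℂ) ^ ((j : ℕ) + 1) * a j) * X ^ (n - ((j : ℕ) + 1))).degree < (n : WithBot ℕ) := by
  refine (degree_sum_le _ _).trans_lt ?_
  refine (Finset.sup_lt_iff <| WithBot.bot_lt_coe n).2 fun k _ => ?_
  refine (degree_C_mul_X_pow_le _ _).trans_lt ?_
  have := k.2
  exact WithBot.coe_lt_coe.2 (show n - ((k:ℕ)+1) < n by omega)

lemma monicPoly_monic (n : ℕ) (a : Fin n → ℂ) : (monicPoly n a).Monic :=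
  monic_X_pow_add (monicPoly_deg_aux n a)

lemma monicPoly_degree (n : ℕ) (a : Fin n → ℂ) : (monicPoly n a).degree = n := by
  rw [monicPoly, degree_add_eq_left_of_degree_lt] <;> rw [degree_X_pow]
  exact monicPoly_deg_aux n a

lemma monicPoly_exists (n : ℕ) (a : Fin n → ℂ) :
    ∃ y : Fin n → ℂ, monicPoly n a = ∏ j, (X - C (y j)) := by
  have hs := IsAlgClosed.splits (monicPoly n a)
  have h1 := hs.eq_prod_roots_of_monic (monicPoly_monic n a)
  have h2 := hs.natDegree_eq_card_roots
  rw [natDegree_eq_of_degree_eq_some (monicPoly_degree n a)] at h2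
  obtain ⟨L, hL⟩ := Quot.exists_rep (monicPoly n a).roots
  change (L : Multiset ℂ) = _ at hL
  rw [← hL, Multiset.coe_card] at h2
  subst h2
  refine ⟨L.get, h1.trans ?_⟩
  rw [← hL, Multiset.map_coe, Multiset.prod_coe, ← List.prod_ofFn]
  congr 1
  conv_lhs => rw [← List.ofFn_get L, List.map_ofFn]
  rfl

lemma root_bound (n : ℕ) (a : Fin n → ℂ) (z : ℂ) (hz : (monicPoly n a).eval z = 0) :
    ‖z‖ ≤ 1 + ∑ j, ‖a j‖ := by
  have hS : 0 ≤ ∑ j, ‖a j‖ := Finset.sum_nonneg fun _ _ => norm_nonneg _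
  by_contra! hcon
  have h1 : 1 ≤ ‖z‖ := by linarith
  simp only [monicPoly, eval_add, eval_pow, eval_X, eval_finsetSum, eval_mul, eval_C] at hz
  have h2 : ‖z‖ ^ n ≤ (∑ j, ‖a j‖) * ‖z‖ ^ (n - 1) := by
    rw [← norm_pow, eq_neg_of_add_eq_zero_left hz, norm_neg, Finset.sum_mul]
    refine (norm_sum_le _ _).trans (Finset.sum_le_sum fun j _ => ?_)
    rw [norm_mul, norm_mul, norm_pow, norm_neg, norm_one, one_pow, one_mul, norm_pow]
    gcongr
    omega
  rcases n with _ | n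
  · simp at hz
  · rw [pow_succ', Nat.add_sub_cancel] at h2
    have := le_of_mul_le_mul_right h2 (by positivity)
    linarith

/-- The roots of a monic polynomial whose coefficients depend continuously on a real
parameter admit a continuous parameterization. -/
theorem continuous_roots_of_continuous_coeffs (n : ℕ) (hn : 1 ≤ n)
    (a : Fin n → ℝ → ℂ) (ha : ∀ j, Continuous (a j)) :
    ∃ l : Fin n → ℝ → ℂ, (∀ j, Continuous (l j)) ∧
      ∀ t : ℝ, monicPoly n (fun j => a j t) = ∏ j : Fin n, (X - C (l j t)) := by
  classical
  have ext : ∀ f g : Polynomial ℂ, f.Monic → g.Monic → f.degree = n → g.degree = n →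
      (∀ i : Fin n, f.eval ((i:ℕ):ℂ) = g.eval ((i:ℕ):ℂ)) → f = g := by
    intro f g hf hg df dg h
    refine eq_of_degree_le_of_eval_finset_eq
      (Finset.univ.image fun i : Fin n => (((i:ℕ):ℂ))) ?_ (df.trans dg.symm) ?_ ?_
    · rw [Finset.card_image_of_injective, Finset.card_univ, Fintype.card_fin, df]
      intro i j hij
      have hij' : (((i:ℕ):ℂ)) = ((j:ℕ):ℂ) := hij
      exact Fin.ext (by exact_mod_cast hij')
    · rw [hf.leadingCoeff, hg.leadingCoeff]
    · intro x hx
      obtain ⟨i, -, rfl⟩ := Finset.mem_image.1 hx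
      exact h i
  have pm : ∀ y : Fin n → ℂ, (∏ j, (X - C (y j))).Monic :=
    fun y => monic_prod_of_monic _ _ fun j _ => monic_X_sub_C _
  have pd : ∀ y : Fin n → ℂ, (∏ j, (X - C (y j))).degree = (n : WithBot ℕ) := by
    intro y
    rw [degree_prod]
    simp
  have hev : ∀ (y : Fin n → ℂ) (z : ℂ), (∏ j, (X - C (y j))).eval z = ∏ j, (z - y j) := by
    intro y z
    simp [eval_prod]
  have conv : ∀ t (y : Fin n → ℂ), (fun i : Fin n => ∏ j, (((i:ℕ):ℂ) - y j)) =
      (fun i : Fin n => (monicPoly n (fun j => a j t)).eval ((i:ℕ):ℂ)) →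
      monicPoly n (fun j => a j t) = ∏ j, (X - C (y j)) := by
    intro t y h
    refine ext _ _ (monicPoly_monic _ _) (pm y) (monicPoly_degree _ _) (pd y) fun i => ?_
    rw [hev]
    exact (congrFun h i).symm
  obtain ⟨l, hl, hl2⟩ := abstract_main n (fun y i => ∏ j, (((i:ℕ):ℂ) - y j)) (by fun_prop)
    (fun x y h => perm_of_prod_eq n x y (ext _ _ (pm x) (pm y) (pd x) (pd y) fun i => by
      rw [hev, hev]; exact congrFun h i))
    (fun y σ => funext fun i => Equiv.prod_comp σ fun j => (((i:ℕ):ℂ) - y j))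
    (fun t i => (monicPoly n (fun j => a j t)).eval ((i:ℕ):ℂ))
    (by
      simp only [monicPoly, eval_add, eval_pow, eval_X, eval_finsetSum, eval_mul, eval_C]
      fun_prop)
    (fun t => by
      obtain ⟨y, hy⟩ := monicPoly_exists n (fun j => a j t)
      refine ⟨y, ?_⟩
      funext i
      rw [hy, hev])
    (fun t => 1 + ∑ j, ‖a j t‖) (by fun_prop)
    (fun t y h => by
      have h1 := conv t y h
      refine (pi_norm_le_iff_of_nonneg (by positivity)).2 fun j => ?_
      refine root_bound n _ _ ?_
      rw [h1, hev]
      exact Finset.prod_eq_zero (Finset.mem_univ j) (sub_self _))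
  exact ⟨fun j t => l t j, fun j => (continuous_apply j).comp hl, fun t => conv t _ (hl2 t)⟩
end

section
/- Formal roots yield analytic roots: let a_1, …, a_n : I → ℂ be real-analytic functions on an open interval I ∋ 0 in ℝ, and let â_j ∈ ℂ[[t]] denote the Taylor series of a_j at 0. Suppose there exist formal power series Λ_1, …, Λ_n ∈ ℂ[[t]] such that z^n + ∑_{j=1}^n (−1)^j â_j(t) z^{n−j} = ∏_{j=1}^n (z − Λ_j(t)) in ℂ[[t]][z]. Then there exist an open interval J ∋ 0 with J ⊆ I and real-analytic functions λ_1, …, λ_n : J → ℂ such that z^n + ∑_{j=1}^n (−1)^j a_j(t) z^{n−j} = ∏_{j=1}^n (z − λ_j(t)) for all t ∈ J, and the Taylor series of λ_j at 0 equals Λ_j for every j. -/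
open Polynomial

/-- The monic polynomial `z^n + ∑_{j=1}^n (-1)^j a_j z^{n-j}` with coefficients in a
commutative ring `R`; `a j` (for `j : Fin n`) corresponds to the coefficient `a_{j+1}`. -/
noncomputable def monicPolyR {R : Type*} [CommRing R] (n : ℕ) (a : Fin n → R) : Polynomial R :=
  X ^ n + ∑ j : Fin n, C ((-1 : R) ^ ((j : ℕ) + 1) * a j) * X ^ (n - ((j : ℕ) + 1))

/-- The Taylor series at `0` of a function `f : ℝ → ℂ`, as a formal power series
`∑_k (f^{(k)}(0)/k!) tᵏ ∈ ℂ[[t]]`. -/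
noncomputable def taylorSeriesAt0 (f : ℝ → ℂ) : PowerSeries ℂ :=
  PowerSeries.mk fun k => (k.factorial : ℂ)⁻¹ * iteratedDeriv k f 0


/-- Partial weighted `ℓ¹` norm of a power series. -/
noncomputable def pnorm (r : ℝ) (N : ℕ) (f : PowerSeries ℂ) : ℝ :=
  ∑ k ∈ Finset.range N, ‖PowerSeries.coeff k f‖ * r ^ k

lemma pnorm_nonneg {r : ℝ} (hr : 0 ≤ r) (N : ℕ) (f : PowerSeries ℂ) : 0 ≤ pnorm r N f :=
  Finset.sum_nonneg fun _ _ => by positivity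

lemma pnorm_zero (r : ℝ) (N : ℕ) : pnorm r N 0 = 0 := by simp [pnorm]

lemma pnorm_neg (r : ℝ) (N : ℕ) (f : PowerSeries ℂ) : pnorm r N (-f) = pnorm r N f := by
  simp [pnorm]

lemma pnorm_add {r : ℝ} (hr : 0 ≤ r) (N : ℕ) (f g : PowerSeries ℂ) :
    pnorm r N (f + g) ≤ pnorm r N f + pnorm r N g := by
  unfold pnorm
  rw [← Finset.sum_add_distrib]
  refine Finset.sum_le_sum fun k _ => ?_
  rw [← add_mul, map_add]
  gcongr
  exact norm_add_le _ _

lemma pnorm_mono {r s : ℝ} (hr : 0 ≤ r) (hrs : r ≤ s) (N : ℕ) (f : PowerSeries ℂ) :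
    pnorm r N f ≤ pnorm s N f := by
  unfold pnorm
  gcongr

lemma pnorm_X_mul (r : ℝ) (N : ℕ) (f : PowerSeries ℂ) :
    pnorm r (N + 1) (PowerSeries.X * f) = r * pnorm r N f := by
  unfold pnorm
  rw [Finset.sum_range_succ']
  simp only [PowerSeries.coeff_succ_X_mul, PowerSeries.coeff_zero_X_mul, norm_zero, zero_mul,
    add_zero, Finset.mul_sum]
  refine Finset.sum_congr rfl fun k _ => ?_
  ring

lemma pnorm_C_le {r : ℝ} (N : ℕ) (c : ℂ) :
    pnorm r N (PowerSeries.C c) ≤ ‖c‖ := by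
  unfold pnorm
  cases N with
  | zero => simp
  | succ N =>
    rw [Finset.sum_range_succ']
    simp [PowerSeries.coeff_C]

lemma pnorm_mul {r : ℝ} (hr : 0 ≤ r) (N : ℕ) (f g : PowerSeries ℂ) :
    pnorm r N (f * g) ≤ pnorm r N f * pnorm r N g := by
  unfold pnorm
  rw [Finset.sum_mul_sum, ← Finset.sum_product']
  calc _ ≤ ∑ k ∈ Finset.range N, ∑ x ∈ Finset.HasAntidiagonal.antidiagonal k,
        (‖PowerSeries.coeff x.1 f‖ * r ^ x.1) * (‖PowerSeries.coeff x.2 g‖ * r ^ x.2) := by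
        refine Finset.sum_le_sum fun k _ => ?_
        rw [PowerSeries.coeff_mul]
        refine (mul_le_mul_of_nonneg_right (norm_sum_le _ _) (by positivity)).trans ?_
        rw [Finset.sum_mul]
        refine Finset.sum_le_sum fun x hx => ?_
        rw [Finset.HasAntidiagonal.mem_antidiagonal] at hx
        rw [← hx, pow_add, norm_mul]
        apply le_of_eq
        ring
    _ = ∑ x ∈ (Finset.range N).biUnion (fun k => Finset.HasAntidiagonal.antidiagonal k),
        (‖PowerSeries.coeff x.1 f‖ * r ^ x.1) * (‖PowerSeries.coeff x.2 g‖ * r ^ x.2) := by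
        rw [Finset.sum_biUnion]
        intro i _ j _ hij
        rw [Function.onFun, Finset.disjoint_left]
        intro x hx hx'
        rw [Finset.HasAntidiagonal.mem_antidiagonal] at hx hx'
        exact hij (hx.symm.trans hx')
    _ ≤ _ := by
        refine Finset.sum_le_sum_of_subset_of_nonneg ?_ fun _ _ _ => by positivity
        intro x hx
        simp only [Finset.mem_biUnion, Finset.HasAntidiagonal.mem_antidiagonal, Finset.mem_range,
          Finset.mem_product] at hx ⊢
        obtain ⟨k, hk, hx⟩ := hx
        omega

/-- Power series which are absolutely convergent at radius `r`. -/
noncomputable def convR (r : ℝ) (hr : 0 ≤ r) : Subring (PowerSeries ℂ) where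
  carrier := {f | ∃ C, ∀ N, pnorm r N f ≤ C}
  mul_mem' := by
    rintro f g ⟨C, hC⟩ ⟨D, hD⟩
    refine ⟨C * D, fun N => (pnorm_mul hr N f g).trans ?_⟩
    exact mul_le_mul (hC N) (hD N) (pnorm_nonneg hr _ _) ((pnorm_nonneg hr _ _).trans (hC N))
  one_mem' := ⟨1, fun N => by simpa using pnorm_C_le (r := r) N 1⟩
  add_mem' := by
    rintro f g ⟨C, hC⟩ ⟨D, hD⟩
    exact ⟨C + D, fun N => (pnorm_add hr N f g).trans (add_le_add (hC N) (hD N))⟩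
  zero_mem' := ⟨0, fun N => (pnorm_zero r N).le⟩
  neg_mem' := by
    rintro f ⟨C, hC⟩
    exact ⟨C, fun N => (pnorm_neg r N f).trans_le (hC N)⟩

lemma convR_mono {r s : ℝ} (hr : 0 ≤ r) (hrs : r ≤ s) :
    convR s (hr.trans hrs) ≤ convR r hr := by
  rintro f ⟨C, hC⟩
  exact ⟨C, fun N => (pnorm_mono hr hrs N f).trans (hC N)⟩

/-- The ring of convergent power series. -/
noncomputable def convS : Subring (PowerSeries ℂ) where
  carrier := {f | ∃ r, ∃ hr : 0 < r, f ∈ convR r hr.le}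
  mul_mem' := by
    rintro f g ⟨r, hr, hf⟩ ⟨s, hs, hg⟩
    have h : 0 < min r s := lt_min hr hs
    exact ⟨min r s, h, mul_mem (convR_mono h.le (min_le_left _ _) hf)
      (convR_mono h.le (min_le_right _ _) hg)⟩
  one_mem' := ⟨1, one_pos, one_mem _⟩
  add_mem' := by
    rintro f g ⟨r, hr, hf⟩ ⟨s, hs, hg⟩
    have h : 0 < min r s := lt_min hr hs
    exact ⟨min r s, h, add_mem (convR_mono h.le (min_le_left _ _) hf)
      (convR_mono h.le (min_le_right _ _) hg)⟩
  zero_mem' := ⟨1, one_pos, zero_mem _⟩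
  neg_mem' := by
    rintro f ⟨r, hr, hf⟩
    exact ⟨r, hr, neg_mem hf⟩

lemma algMap_convS (x : convS) : algebraMap convS (PowerSeries ℂ) x = (x : PowerSeries ℂ) := rfl

lemma convS_C (c : ℂ) : PowerSeries.C c ∈ convS :=
  ⟨1, one_pos, ‖c‖, fun N => pnorm_C_le N c⟩

lemma convS_X : PowerSeries.X ∈ convS := by
  refine ⟨1, one_pos, 1, fun N => ?_⟩
  cases N with
  | zero => simp [pnorm]
  | succ N =>
    rw [← mul_one PowerSeries.X, pnorm_X_mul, one_mul]
    simpa using pnorm_C_le (r := 1) N 1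

lemma convS_of_X_mul {f : PowerSeries ℂ} (h : PowerSeries.X * f ∈ convS) : f ∈ convS := by
  obtain ⟨r, hr, C, hC⟩ := h
  refine ⟨r, hr, C / r, fun N => ?_⟩
  rw [le_div_iff₀ hr, mul_comm, ← pnorm_X_mul]
  exact hC _

lemma convS_of_X_pow_mul {f : PowerSeries ℂ} (m : ℕ) (h : PowerSeries.X ^ m * f ∈ convS) :
    f ∈ convS := by
  induction m with
  | zero => simpa using h
  | succ m ih =>
    apply ih
    apply convS_of_X_mul
    rwa [← mul_assoc, ← pow_succ']

lemma convS_poly (p : Polynomial ℂ) : (p : PowerSeries ℂ) ∈ convS := by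
  induction p using Polynomial.induction_on with
  | C a => simpa using convS_C a
  | add p q hp hq => simpa using add_mem hp hq
  | monomial n a h =>
    simpa using mul_mem (convS_C a) (pow_mem convS_X (n + 1))

lemma convS_poly_bound (G : Polynomial convS) (M : ℝ) (hM : 0 ≤ M) :
    ∃ r₀, 0 < r₀ ∧ ∃ D, 0 ≤ D ∧ ∀ r, 0 < r → r ≤ r₀ → ∀ N, ∀ w : PowerSeries ℂ,
      pnorm r N w ≤ M → pnorm r N (aeval w G) ≤ D := by
  induction G using Polynomial.induction_on' with
  | add p q hp hq =>
    obtain ⟨r₁, h₁, D₁, hD₁, H₁⟩ := hp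
    obtain ⟨r₂, h₂, D₂, hD₂, H₂⟩ := hq
    refine ⟨min r₁ r₂, lt_min h₁ h₂, D₁ + D₂, by positivity, fun r hr hr' N w hw => ?_⟩
    rw [map_add]
    exact (pnorm_add hr.le _ _ _).trans (add_le_add
      (H₁ r hr (hr'.trans (min_le_left _ _)) N w hw)
      (H₂ r hr (hr'.trans (min_le_right _ _)) N w hw))
  | monomial n c =>
    obtain ⟨c, s, hs, C, hC⟩ := c
    have hC0 : 0 ≤ C := (pnorm_nonneg hs.le 0 c).trans (hC 0)
    refine ⟨s, hs, C * M ^ n, by positivity, fun r hr hr' N w hw => ?_⟩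
    rw [aeval_monomial]
    change pnorm r N (c * w ^ n) ≤ _
    have hc : pnorm r N c ≤ C := (pnorm_mono hr.le hr' N c).trans (hC N)
    clear hC hs hr'
    induction n with
    | zero => simpa using hc
    | succ n ih =>
      rw [pow_succ, pow_succ, ← mul_assoc, ← mul_assoc]
      exact (pnorm_mul hr.le _ _ _).trans
        (mul_le_mul ih hw (pnorm_nonneg hr.le _ _) (by positivity))

/-- Core convergence estimate. -/
lemma convS_of_fixed (e : convS) (G : Polynomial convS) (w : PowerSeries ℂ)
    (h : w = (e : PowerSeries ℂ) + PowerSeries.X * aeval w G) : w ∈ convS := by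
  obtain ⟨e, s, hs, E, hE⟩ := e
  have hE0 : 0 ≤ E := (pnorm_nonneg hs.le 0 e).trans (hE 0)
  obtain ⟨r₀, hr₀, D, hD, H⟩ := convS_poly_bound G (E + 1) (by positivity)
  have hD1 : 0 < 1 / (D + 1) := by positivity
  obtain ⟨r, hr, h1, h2, h3⟩ : ∃ r, 0 < r ∧ r ≤ s ∧ r ≤ r₀ ∧ r ≤ 1 / (D + 1) :=
    ⟨min s (min r₀ (1 / (D + 1))), lt_min hs (lt_min hr₀ hD1), min_le_left _ _,
      (min_le_right _ _).trans (min_le_left _ _), (min_le_right _ _).trans (min_le_right _ _)⟩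
  refine ⟨r, hr, E + 1, fun N => ?_⟩
  induction N with
  | zero => simp only [pnorm, Finset.range_zero, Finset.sum_empty]; positivity
  | succ N ih =>
    rw [h]
    refine (pnorm_add hr.le _ _ _).trans
      (add_le_add ((pnorm_mono hr.le h1 _ _).trans (hE _)) ?_)
    rw [pnorm_X_mul]
    calc r * pnorm r N (aeval w G) ≤ 1 / (D + 1) * D :=
          mul_le_mul h3 (H r hr h2 N w ih) (pnorm_nonneg hr.le _ _) hD1.le
      _ ≤ 1 := by rw [div_mul_eq_mul_div, div_le_one (by positivity)]; linarith

/-- A simple root (a root at which the derivative does not vanish) is convergent. -/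
lemma convS_of_simple_root (Q : Polynomial convS) (L : PowerSeries ℂ)
    (h0 : aeval L Q = 0) (h1 : aeval L (derivative Q) ≠ 0) : L ∈ convS := by
  obtain ⟨m, g, hg, hg0⟩ : ∃ m, ∃ g, aeval L (derivative Q) = PowerSeries.X ^ m * g ∧
      PowerSeries.constantCoeff g ≠ 0 :=
    ⟨_, _, PowerSeries.X_pow_order_mul_divXPowOrder.symm,
      fun h => h1 (PowerSeries.constantCoeff_divXPowOrder_eq_zero_iff.1 h)⟩
  obtain ⟨w, hw⟩ : PowerSeries.X ^ (m + 1) ∣ L - (PowerSeries.trunc (m + 1) L : PowerSeries ℂ) := by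
    rw [PowerSeries.X_pow_dvd_iff]
    intro k hk
    simp [PowerSeries.coeff_trunc, hk]
  set p : convS := ⟨(PowerSeries.trunc (m + 1) L : PowerSeries ℂ), convS_poly _⟩ with hp
  have hL : L = PowerSeries.X ^ (m + 1) * w + (p : PowerSeries ℂ) := by rw [← hw]; simp [hp]
  suffices hwc : w ∈ convS by
    rw [hL]
    exact add_mem (mul_mem (pow_mem convS_X _) hwc) p.2
  set T := taylor p Q with hT
  have hTL : aeval (PowerSeries.X ^ (m + 1) * w) T = 0 := by
    rw [← h0, hL, hT, taylor_apply, aeval_comp]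
    simp [algMap_convS]
  have hexp : T = C (T.coeff 0) + C (T.coeff 1) * X + X ^ 2 * (divX (divX T)) := by
    conv_lhs => rw [← divX_mul_X_add T, ← divX_mul_X_add (divX T)]
    simp only [coeff_divX]
    ring
  -- the linear coefficient
  obtain ⟨u, hu, hu0⟩ : ∃ u : PowerSeries ℂ, (T.coeff 1 : PowerSeries ℂ) = PowerSeries.X ^ m * u ∧
      PowerSeries.constantCoeff u = PowerSeries.constantCoeff g := by
    have hd := sub_dvd_eval_sub L (p : PowerSeries ℂ)
      ((derivative Q).map (algebraMap convS (PowerSeries ℂ)))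
    rw [hw] at hd
    obtain ⟨v, hv⟩ := hd
    refine ⟨g - PowerSeries.X * (w * v), ?_, by simp⟩
    rw [eval_map_algebraMap, eval_map_algebraMap, hg] at hv
    have h2 : (T.coeff 1 : PowerSeries ℂ) = aeval (p : PowerSeries ℂ) (derivative Q) := by
      rw [hT, taylor_coeff_one]
      exact (aeval_algebraMap_apply_eq_algebraMap_eval p (derivative Q)).symm
    rw [h2]
    linear_combination -hv
  have huc : u ∈ convS := convS_of_X_pow_mul m (hu ▸ (T.coeff 1).2)
  obtain ⟨v, hv⟩ : PowerSeries.X ∣ u - PowerSeries.C (PowerSeries.constantCoeff g) := by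
    rw [PowerSeries.X_dvd_iff]; simp [hu0]
  have hvc : v ∈ convS := convS_of_X_mul (hv ▸ sub_mem huc (convS_C _))
  set K : PowerSeries ℂ := aeval (PowerSeries.X ^ (m + 1) * w) (divX (divX T)) with hK
  have heq : (T.coeff 0 : PowerSeries ℂ) + PowerSeries.X ^ (2 * m + 1) *
      (u * w + PowerSeries.X * (w ^ 2 * K)) = 0 := by
    rw [← hTL]
    conv_rhs => rw [hexp]
    simp only [map_add, map_mul, aeval_C, aeval_X, map_pow, ← hK,
      algMap_convS, hu]
    ring
  have hcc : -(u * w + PowerSeries.X * (w ^ 2 * K)) ∈ convS := by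
    apply convS_of_X_pow_mul (2 * m + 1)
    have : PowerSeries.X ^ (2 * m + 1) * -(u * w + PowerSeries.X * (w ^ 2 * K)) =
      (T.coeff 0 : PowerSeries ℂ) := by linear_combination -heq
    rw [this]
    exact (T.coeff 0).2
  set c := -(u * w + PowerSeries.X * (w ^ 2 * K)) with hc
  set i : PowerSeries ℂ := PowerSeries.C (PowerSeries.constantCoeff g)⁻¹ with hi
  have hi1 : i * PowerSeries.C (PowerSeries.constantCoeff g) = 1 := by
    rw [hi, ← map_mul, inv_mul_cancel₀ hg0, map_one]
  let i' : convS := ⟨i, convS_C _⟩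
  let v' : convS := ⟨v, hvc⟩
  let c' : convS := ⟨c, hcc⟩
  let t' : convS := ⟨PowerSeries.X, convS_X⟩
  refine convS_of_fixed (-(i' * c'))
    (-(C i' * (C v' * X + X ^ 2 * (divX (divX T)).comp (C (t' ^ (m + 1)) * X)))) w ?_
  simp only [map_neg, map_mul, map_add, aeval_C, aeval_X, map_pow, aeval_comp,
    algMap_convS]
  change w = -(i * c) + PowerSeries.X * -(i * (v * w + w ^ 2 *
    aeval (PowerSeries.X ^ (m + 1) * w) (divX (divX T))))
  rw [← hK]
  linear_combination (-w) * hi1 - i * hc - i * w * hv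

/-- Formal roots of monic polynomials with convergent coefficients converge. -/
lemma convS_of_root (P : Polynomial convS) (hP : P.Monic) (L : PowerSeries ℂ)
    (h0 : aeval L P = 0) : L ∈ convS := by
  have hex : ∃ k, aeval L (derivative^[k] P) ≠ 0 := by
    refine ⟨P.natDegree, ?_⟩
    have hdeg : (derivative^[P.natDegree] P).natDegree = 0 :=
      Nat.le_zero.1 ((natDegree_iterate_derivative P P.natDegree).trans (by simp))
    rw [eq_C_of_natDegree_eq_zero hdeg, coeff_iterate_derivative, zero_add,
      Nat.descFactorial_self, hP.coeff_natDegree]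
    have h3 : ((P.natDegree.factorial : ℕ) : PowerSeries ℂ) ≠ 0 := by
      intro h
      have h4 := congrArg PowerSeries.constantCoeff h
      rw [map_natCast, map_zero] at h4
      exact Nat.factorial_ne_zero _ (Nat.cast_eq_zero.1 h4)
    simpa using h3
  classical
  have h1 := Nat.find_spec hex
  have h2 := fun k => Nat.find_min hex (m := k)
  obtain ⟨k, hk⟩ : ∃ k, Nat.find hex = k + 1 := by
    refine Nat.exists_eq_succ_of_ne_zero fun h => ?_
    rw [h] at h1
    exact h1 h0
  rw [hk] at h1 h2
  refine convS_of_simple_root (derivative^[k] P) L (not_not.1 (h2 k (by omega))) ?_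
  rwa [← Function.iterate_succ_apply' (f := derivative)]

lemma convR_summable {r : ℝ} (hr : 0 ≤ r) {f : PowerSeries ℂ} (hf : f ∈ convR r hr) :
    Summable fun k => ‖PowerSeries.coeff k f‖ * r ^ k := by
  obtain ⟨C, hC⟩ := hf
  exact summable_of_sum_range_le (fun _ => by positivity) hC

lemma convR_of_summable {r : ℝ} (hr : 0 ≤ r) {f : PowerSeries ℂ}
    (hf : Summable fun k => ‖PowerSeries.coeff k f‖ * r ^ k) : f ∈ convR r hr :=
  ⟨_, fun N => hf.sum_le_tsum (Finset.range N) (fun _ _ => by positivity)⟩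

lemma convR_summable_eval {r : ℝ} (hr : 0 ≤ r) {f : PowerSeries ℂ} (hf : f ∈ convR r hr)
    {t : ℝ} (ht : |t| ≤ r) : Summable fun k => ‖PowerSeries.coeff k f * (t : ℂ) ^ k‖ := by
  refine (convR_summable hr hf).of_nonneg_of_le (fun _ => norm_nonneg _) fun k => ?_
  rw [norm_mul, norm_pow, Complex.norm_real, Real.norm_eq_abs]
  gcongr

/-- Evaluation of convergent power series at a point. -/
noncomputable def evalR (r : ℝ) (hr : 0 ≤ r) (t : ℝ) (ht : |t| ≤ r) : convR r hr →+* ℂ where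
  toFun f := ∑' k, PowerSeries.coeff k (f : PowerSeries ℂ) * (t : ℂ) ^ k
  map_one' := by
    rw [tsum_eq_single 0]
    · simp
    · intro k hk
      simp [PowerSeries.coeff_one, hk]
  map_zero' := by simp
  map_add' f g := by
    rw [← ((convR_summable_eval hr f.2 ht).of_norm).tsum_add
      ((convR_summable_eval hr g.2 ht).of_norm)]
    refine tsum_congr fun k => ?_
    simp [add_mul]
  map_mul' f g := by
    rw [tsum_mul_tsum_eq_tsum_sum_antidiagonal_of_summable_norm
      (convR_summable_eval hr f.2 ht) (convR_summable_eval hr g.2 ht)]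
    refine tsum_congr fun k => ?_
    change PowerSeries.coeff k ((f : PowerSeries ℂ) * (g : PowerSeries ℂ)) * _ = _
    rw [PowerSeries.coeff_mul, Finset.sum_mul]
    refine Finset.sum_congr rfl fun x hx => ?_
    rw [Finset.HasAntidiagonal.mem_antidiagonal] at hx
    rw [← hx, pow_add]
    ring

lemma monicPolyR_map {R S : Type*} [CommRing R] [CommRing S] (φ : R →+* S) (n : ℕ)
    (a : Fin n → R) : (monicPolyR n a).map φ = monicPolyR n (fun j => φ (a j)) := by
  simp [monicPolyR, Polynomial.map_sum]

lemma monicPolyR_eq_map_subring (S : Subring (PowerSeries ℂ)) (n : ℕ)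
    (a : Fin n → PowerSeries ℂ) (ha : ∀ j, a j ∈ S) :
    (monicPolyR n (fun j => (⟨a j, ha j⟩ : S))).map S.subtype = monicPolyR n a := by
  rw [monicPolyR_map]
  rfl

lemma taylor_eq_of_hasFPowerSeries {f : ℝ → ℂ} {p : FormalMultilinearSeries ℝ ℝ ℂ}
    {r : ENNReal} (h : HasFPowerSeriesOnBall f p 0 r) (k : ℕ) :
    PowerSeries.coeff k (taylorSeriesAt0 f) = p.coeff k := by
  have h1 := h.factorial_smul 1 k
  rw [taylorSeriesAt0, PowerSeries.coeff_mk, iteratedDeriv_eq_iteratedFDeriv, ← h1,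
    nsmul_eq_mul, ← mul_assoc, inv_mul_cancel₀ (by exact_mod_cast Nat.factorial_ne_zero k),
    one_mul]
  rfl

/-- Taylor series of analytic functions converge to the function. -/
lemma taylor_conv {f : ℝ → ℂ} (hf : AnalyticAt ℝ f 0) :
    ∃ r, ∃ hr : 0 < r, taylorSeriesAt0 f ∈ convR r hr.le ∧
      ∀ t : ℝ, |t| < r → f t = ∑' k, PowerSeries.coeff k (taylorSeriesAt0 f) * (t : ℂ) ^ k := by
  obtain ⟨p, R, hp⟩ := hf
  obtain ⟨r, hr0, hrR⟩ := ENNReal.lt_iff_exists_nnreal_btwn.1 hp.r_pos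
  have hr : 0 < (r : ℝ) := by exact_mod_cast hr0
  refine ⟨r, hr, convR_of_summable _ ?_, fun t ht => ?_⟩
  · have := p.summable_norm_mul_pow (hrR.trans_le hp.r_le)
    refine this.congr fun k => ?_
    rw [taylor_eq_of_hasFPowerSeries hp, FormalMultilinearSeries.norm_apply_eq_norm_coef]
  · have ht' : t ∈ Metric.eball (0 : ℝ) R := by
      rw [Metric.mem_eball, edist_zero_right]
      refine lt_trans ?_ hrR
      rw [enorm_eq_nnnorm]
      norm_cast
    have h := hp.hasSum ht'
    rw [zero_add] at h
    rw [← h.tsum_eq]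
    refine tsum_congr fun k => ?_
    rw [taylor_eq_of_hasFPowerSeries hp, FormalMultilinearSeries.apply_eq_pow_smul_coeff,
      Complex.real_smul, mul_comm]
    push_cast
    rfl

/-- The sum of a convergent power series. -/
noncomputable def sumPS (L : PowerSeries ℂ) (t : ℝ) : ℂ :=
  ∑' k, PowerSeries.coeff k L * (t : ℂ) ^ k

lemma sumPS_analytic {r : ℝ} (hr : 0 < r) {L : PowerSeries ℂ} (hL : L ∈ convR r hr.le) :
    AnalyticOnNhd ℝ (sumPS L) (Set.Ioo (-r) r) ∧ taylorSeriesAt0 (sumPS L) = L := by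
  let p : FormalMultilinearSeries ℝ ℝ ℂ := fun n =>
    ContinuousMultilinearMap.mkPiRing ℝ (Fin n) (PowerSeries.coeff n L)
  have hpc : ∀ k, p.coeff k = PowerSeries.coeff k L := fun k => by
    simp [p, FormalMultilinearSeries.coeff]
  lift r to NNReal using hr.le
  have hrad : (r : ENNReal) ≤ p.radius := by
    apply p.le_radius_of_summable_norm
    refine (convR_summable _ hL).congr fun k => ?_
    rw [FormalMultilinearSeries.norm_apply_eq_norm_coef, hpc]
  have hr' : (0 : ENNReal) < r := by exact_mod_cast hr
  have hp := (p.hasFPowerSeriesOnBall (hr'.trans_le hrad)).mono hr' hrad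
  have hs : p.sum = sumPS L := by
    funext t
    refine tsum_congr fun k => ?_
    rw [FormalMultilinearSeries.apply_eq_pow_smul_coeff, hpc, Complex.real_smul, mul_comm]
    push_cast
    rfl
  rw [hs] at hp
  constructor
  · refine hp.analyticOnNhd.mono fun t ht => ?_
    rw [Metric.mem_eball, edist_zero_right, enorm_eq_nnnorm]
    have : |t| < r := abs_lt.2 ht
    norm_cast
  · ext k
    rw [taylor_eq_of_hasFPowerSeries hp, hpc]

lemma monicPolyR_monic {R : Type*} [CommRing R] (n : ℕ) (a : Fin n → R) :
    (monicPolyR n a).Monic := by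
  nontriviality R
  refine monic_X_pow_add ?_
  refine (degree_sum_le _ _).trans_lt ?_
  refine (Finset.sup_lt_iff (WithBot.bot_lt_coe n)).2 ?_
  intro j _
  refine (degree_C_mul_X_pow_le _ _).trans_lt ?_
  have := j.2
  exact WithBot.coe_lt_coe.2 (by omega : n - ((j : ℕ) + 1) < n)

lemma exists_common_radius {n : ℕ} (P : Fin n → ℝ → Prop)
    (hP : ∀ j, ∃ r, 0 < r ∧ ∀ s, 0 < s → s ≤ r → P j s) :
    ∃ r, 0 < r ∧ ∀ s, 0 < s → s ≤ r → ∀ j, P j s := by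
  choose ρ hρ hρ' using hP
  by_cases hn : Nonempty (Fin n)
  · refine ⟨Finset.univ.inf' Finset.univ_nonempty ρ, ?_, fun s hs hs' j => ?_⟩
    · rw [Finset.lt_inf'_iff]
      exact fun j _ => hρ j
    · exact hρ' j s hs (hs'.trans (Finset.inf'_le _ (Finset.mem_univ j)))
  · exact ⟨1, one_pos, fun _ _ _ j => (hn ⟨j⟩).elim⟩

/-- Formal roots yield analytic roots: if the Taylor series at `0` of the real-analytic
coefficients `a_j` admit a formal factorization `ẑⁿ + ∑ (-1)^j â_j z^{n-j} = ∏ (z - Λ_j)`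
in `ℂ[[t]][z]`, then on some open interval `(-ε, ε)` the polynomial family admits a
real-analytic parameterization `λ_j` of its roots whose Taylor series at `0` are the `Λ_j`. -/
theorem analytic_roots_of_formal_roots (n : ℕ) (α β : ℝ) (hα : α < 0) (hβ : 0 < β)
    (a : Fin n → ℝ → ℂ) (ha : ∀ j, AnalyticOnNhd ℝ (a j) (Set.Ioo α β))
    (Λ : Fin n → PowerSeries ℂ)
    (hΛ : monicPolyR n (fun j => taylorSeriesAt0 (a j)) =
      ∏ j : Fin n, (X - C (Λ j))) :
    ∃ ε : ℝ, 0 < ε ∧ Set.Ioo (-ε) ε ⊆ Set.Ioo α β ∧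
      ∃ l : Fin n → ℝ → ℂ,
        (∀ j, AnalyticOnNhd ℝ (l j) (Set.Ioo (-ε) ε)) ∧
        (∀ t ∈ Set.Ioo (-ε) ε,
          monicPolyR n (fun j => a j t) = ∏ j : Fin n, (X - C (l j t))) ∧
        ∀ j, taylorSeriesAt0 (l j) = Λ j := by
  have hA : ∀ j, ∃ r, ∃ hr : 0 < r, taylorSeriesAt0 (a j) ∈ convR r hr.le ∧
      ∀ t : ℝ, |t| < r →
        a j t = ∑' k, PowerSeries.coeff k (taylorSeriesAt0 (a j)) * (t : ℂ) ^ k :=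
    fun j => taylor_conv (ha j 0 ⟨hα, hβ⟩)
  have hAc : ∀ j, taylorSeriesAt0 (a j) ∈ convS := fun j => by
    obtain ⟨r, hr, h, _⟩ := hA j
    exact ⟨r, hr, h⟩
  have hLc : ∀ j, Λ j ∈ convS := fun j => by
    refine convS_of_root (monicPolyR n fun j => (⟨_, hAc j⟩ : convS)) (monicPolyR_monic _ _) _ ?_
    rw [← eval_map_algebraMap]
    change eval (Λ j) ((monicPolyR n fun j => (⟨_, hAc j⟩ : convS)).map convS.subtype) = 0
    rw [monicPolyR_eq_map_subring, hΛ, eval_prod]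
    exact Finset.prod_eq_zero (Finset.mem_univ j) (by simp)
  obtain ⟨r₁, hr₁, H₁⟩ := exists_common_radius
    (fun j s => ∃ hs : 0 < s, taylorSeriesAt0 (a j) ∈ convR s hs.le ∧
      ∀ t : ℝ, |t| < s →
        a j t = ∑' k, PowerSeries.coeff k (taylorSeriesAt0 (a j)) * (t : ℂ) ^ k)
    (fun j => by
      obtain ⟨r, hr, h, h'⟩ := hA j
      exact ⟨r, hr, fun s hs hsr => ⟨hs, convR_mono hs.le hsr h,
        fun t ht => h' t (ht.trans_le hsr)⟩⟩)
  obtain ⟨r₂, hr₂, H₂⟩ := exists_common_radius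
    (fun j s => ∃ hs : 0 < s, Λ j ∈ convR s hs.le)
    (fun j => by
      obtain ⟨r, hr, h⟩ := hLc j
      exact ⟨r, hr, fun s hs hsr => ⟨hs, convR_mono hs.le hsr h⟩⟩)
  obtain ⟨ε, hε, h1, h2, h3, h4⟩ : ∃ ε, 0 < ε ∧ ε ≤ r₁ ∧ ε ≤ r₂ ∧ ε ≤ -α ∧ ε ≤ β := by
    refine ⟨min (min r₁ r₂) (min (-α) β), ?_, ?_, ?_, ?_, ?_⟩
    · exact lt_min (lt_min hr₁ hr₂) (lt_min (by linarith) hβ)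
    · exact (min_le_left _ _).trans (min_le_left _ _)
    · exact (min_le_left _ _).trans (min_le_right _ _)
    · exact (min_le_right _ _).trans (min_le_left _ _)
    · exact (min_le_right _ _).trans (min_le_right _ _)
  have K₁ := H₁ ε hε h1
  have K₂ := H₂ ε hε h2
  have M₁ : ∀ j, taylorSeriesAt0 (a j) ∈ convR ε hε.le := fun j => (K₁ j).2.1
  have M₂ : ∀ j, Λ j ∈ convR ε hε.le := fun j => (K₂ j).2
  refine ⟨ε, hε, Set.Ioo_subset_Ioo (by linarith) h4, fun j => sumPS (Λ j),
    fun j => (sumPS_analytic hε (M₂ j)).1, fun t ht => ?_, fun j => (sumPS_analytic hε (M₂ j)).2⟩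
  have ht' : |t| < ε := abs_lt.2 ht
  have key : monicPolyR n (fun j => (⟨_, M₁ j⟩ : convR ε hε.le)) =
      ∏ j : Fin n, (X - C (⟨_, M₂ j⟩ : convR ε hε.le)) := by
    apply Polynomial.map_injective (convR ε hε.le).subtype Subtype.val_injective
    rw [monicPolyR_eq_map_subring, hΛ, Polynomial.map_prod]
    refine Finset.prod_congr rfl fun j _ => ?_
    rw [Polynomial.map_sub, map_X, map_C]
    rfl
  have key2 := congrArg (Polynomial.map (evalR ε hε.le t ht'.le)) key
  rw [monicPolyR_map, Polynomial.map_prod] at key2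
  have e1 : (fun j => a j t) = fun j => evalR ε hε.le t ht'.le ⟨_, M₁ j⟩ := by
    funext j
    exact (K₁ j).2.2 t ht'
  rw [e1, key2]
  refine Finset.prod_congr rfl fun j _ => ?_
  rw [Polynomial.map_sub, map_X, map_C]
  rfl
end

section
/- Global real-analytic eigenvalues of real-analytic curves of normal matrices: let A : ℝ → M_n(ℂ) be a map whose entries are real-analytic functions and such that A(t) is normal for every t ∈ ℝ. Then there exist real-analytic functions λ_1, …, λ_n : ℝ → ℂ such that for every t ∈ ℝ the multiset {λ_1(t), …, λ_n(t)} equals the multiset of roots, counted with multiplicity, of the characteristic polynomial of A(t); i.e., the eigenvalues of A admit a global real-analytic parameterization. -/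
open Matrix Polynomial

section LocalPart
open Filter Topology
open scoped ContDiff

lemma anticomm_zero {𝔸 : Type*} [NormedRing 𝔸] [NormedAlgebra ℝ 𝔸] {w d : 𝔸} (hw : ‖w - 1‖ < 1)
    (h : d * w + w * d = 0) : d = 0 := by
  have h2 : d + d = -(d * (w - 1) + (w - 1) * d) := by
    have : d * (w - 1) + (w - 1) * d = (d * w + w * d) - (d + d) := by noncomm_ring
    rw [this, h]; simp
  have hd : 2 * ‖d‖ = ‖d * (w - 1) + (w - 1) * d‖ := by
    rw [← norm_neg (d * (w - 1) + (w - 1) * d), ← h2, ← two_smul ℝ, norm_smul]; norm_num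
  have e1 := norm_add_le (d * (w - 1)) ((w - 1) * d)
  have e2 : ‖d * (w - 1)‖ ≤ ‖d‖ * ‖w - 1‖ := norm_mul_le _ _
  have e3 : ‖(w - 1) * d‖ ≤ ‖w - 1‖ * ‖d‖ := norm_mul_le _ _
  by_contra hne
  have hpos : 0 < ‖d‖ := norm_pos_iff.mpr hne
  nlinarith

lemma exists_analytic_sqrt (𝔸 : Type*) [NormedRing 𝔸] [NormedAlgebra ℝ 𝔸] [CompleteSpace 𝔸] :
    ∃ Y : 𝔸 → 𝔸, AnalyticAt ℝ Y 1 ∧ Y 1 = 1 ∧ ∀ᶠ x in 𝓝 (1 : 𝔸), Y x * Y x = x := by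
  let f : 𝔸 → 𝔸 := fun x => x * x
  have hf : ContDiffAt ℝ ω f 1 := by
    apply ContDiffAt.mul <;> exact contDiffAt_id
  let f' : 𝔸 ≃L[ℝ] 𝔸 := ContinuousLinearEquiv.smulLeft (Units.mk0 (2:ℝ) two_ne_zero)
  have hf' : HasFDerivAt f (f' : 𝔸 →L[ℝ] 𝔸) 1 := by
    have := (hasFDerivAt_id (𝕜 := ℝ) (1:𝔸)).mul' (hasFDerivAt_id (1:𝔸))
    refine this.congr_fderiv ?_
    ext x
    simp [f', two_smul, Units.smul_def]
  have h1 : f 1 = 1 := by simp [f]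
  have hs : HasStrictFDerivAt f (f' : 𝔸 →L[ℝ] 𝔸) 1 := hf.hasStrictFDerivAt' hf' (by simp)
  refine ⟨hs.localInverse f f' 1, ?_, ?_, ?_⟩
  · have := hf.to_localInverse hf' (by simp)
    rw [h1] at this
    exact this.analyticAt
  · have := hs.localInverse_apply_image
    rwa [h1] at this
  · have := hs.eventually_right_inverse
    rwa [h1] at this

lemma isSelfAdjoint_aeval_real {𝔸 : Type*} [Ring 𝔸] [StarRing 𝔸] [Algebra ℝ 𝔸] [StarModule ℝ 𝔸]
    {x : 𝔸} (hx : IsSelfAdjoint x) (q : ℝ[X]) : IsSelfAdjoint (aeval x q) := by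
  induction q using Polynomial.induction_on' with
  | add p q hp hq => simpa using hp.add hq
  | monomial n a =>
    rw [aeval_monomial, ← Algebra.smul_def]
    exact (IsSelfAdjoint.all a).smul (hx.pow n)

lemma refine_idempotent {𝔸 : Type*} [CStarAlgebra 𝔸] {M : ℝ → 𝔸} {t₀ : ℝ}
    (hM : AnalyticAt ℝ M t₀) (hsa : ∀ᶠ t in 𝓝 t₀, star (M t) = M t)
    (hid : M t₀ * M t₀ = M t₀) :
    ∃ e : ℝ → 𝔸, AnalyticAt ℝ e t₀ ∧ e t₀ = M t₀ ∧ ∀ᶠ t in 𝓝 t₀,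
      e t * e t = e t ∧ star (e t) = e t ∧ ∀ X : 𝔸, Commute X (M t) → Commute X (e t) := by
  obtain ⟨Y, hY, hY1, hY2⟩ := exists_analytic_sqrt 𝔸
  let S : ℝ → 𝔸 := fun t => 2 * M t - 1
  have hS : AnalyticAt ℝ S t₀ := (analyticAt_const.mul hM).sub analyticAt_const
  have hS1 : S t₀ * S t₀ = 1 := by
    have : S t₀ * S t₀ = 4 * (M t₀ * M t₀) - 4 * M t₀ + 1 := by simp only [S]; noncomm_ring
    rw [this, hid]; simp
  let W : ℝ → 𝔸 := fun t => Ring.inverse (S t * S t)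
  have hSS : AnalyticAt ℝ (fun t => S t * S t) t₀ := hS.mul hS
  have hW : AnalyticAt ℝ W t₀ := by
    refine AnalyticAt.fun_comp (g := Ring.inverse) ?_ hSS
    simp only [hS1]
    exact analyticAt_inverse (1 : 𝔸ˣ)
  have hW1 : W t₀ = 1 := by simp [W, hS1]
  let Z : ℝ → 𝔸 := fun t => Y (W t)
  have hZ : AnalyticAt ℝ Z t₀ := AnalyticAt.fun_comp (g := Y) (by rwa [hW1]) hW
  have hZ1 : Z t₀ = 1 := by simp [Z, hW1, hY1]
  have hunit : ∀ᶠ t in 𝓝 t₀, IsUnit (S t * S t) := by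
    have : {x : 𝔸 | IsUnit x} ∈ 𝓝 (S t₀ * S t₀) := Units.isOpen.mem_nhds (by simp [hS1])
    exact hSS.continuousAt this
  have hsq : ∀ᶠ t in 𝓝 t₀, Z t * Z t = W t := by
    have : Tendsto W (𝓝 t₀) (𝓝 1) := by
      have := hW.continuousAt.tendsto; rwa [hW1] at this
    exact this.eventually hY2
  have hnear : ∀ᶠ t in 𝓝 t₀, ‖Z t - 1‖ < 1 := by
    have : Tendsto (fun t => ‖Z t - 1‖) (𝓝 t₀) (𝓝 0) := by
      have := (hZ.continuousAt.tendsto.sub_const 1).norm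
      rwa [hZ1, sub_self, norm_zero] at this
    exact this.eventually_lt_const one_pos
  refine ⟨fun t => (1/2 : ℝ) • (1 + S t * Z t), ?_, ?_, ?_⟩
  · exact (analyticAt_const.add (hS.mul hZ)).const_smul
  · simp only [hZ1, mul_one, S, add_sub_cancel]
    rw [two_mul, ← two_smul ℝ, smul_smul]; norm_num
  filter_upwards [hsa, hunit, hsq, hnear] with t hsa hunit hsq hnear
  have hcS : ∀ X : 𝔸, Commute X (M t) → Commute X (S t) := fun X hX =>
    ((Commute.ofNat_right X 2).mul_right hX).sub_right (Commute.one_right X)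
  have hcZ : ∀ X : 𝔸, Commute X (M t) → Commute X (Z t) := fun X hX => by
    have h1 : Commute X (W t) := by
      have := (hcS X hX).mul_right (hcS X hX)
      obtain ⟨u, hu⟩ := hunit
      simp only [W, ← hu, Ring.inverse_unit]
      rw [← hu] at this
      exact this.units_inv_right
    rw [← hsq] at h1
    have h2 : X * Z t - Z t * X = 0 := by
      apply anticomm_zero hnear
      have : (X * Z t - Z t * X) * Z t + Z t * (X * Z t - Z t * X)
        = X * (Z t * Z t) - (Z t * Z t) * X := by noncomm_ring
      rw [this, h1.eq, sub_self]
    exact sub_eq_zero.mp h2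
  have hsS : star (S t) = S t := by simp [S, hsa, two_mul]
  have hsW : star (W t) = W t := by
    have : IsSelfAdjoint (S t * S t) := by simp [IsSelfAdjoint, hsS]
    exact this.ringInverse
  have hsZ : star (Z t) = Z t := by
    have h2 : star (Z t) - Z t = 0 := by
      apply anticomm_zero (w := (1/2 : ℝ) • (star (Z t) + Z t))
      · have : (1/2 : ℝ) • (star (Z t) + Z t) - 1 = (1/2 : ℝ) • (star (Z t - 1) + (Z t - 1)) := by
          rw [star_sub, star_one]
          have : (1 : 𝔸) = (1/2:ℝ) • (1 + 1) := by
            rw [← two_smul ℝ, smul_smul]; norm_num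
          nth_rewrite 1 [this]
          rw [← smul_sub]; congr 1; abel
        rw [this, norm_smul]
        have h3 := norm_add_le (star (Z t - 1)) (Z t - 1)
        rw [norm_star] at h3
        rw [Real.norm_of_nonneg (by norm_num)]
        linarith
      · have hh : star (Z t) * star (Z t) = Z t * Z t := by
          rw [← star_mul, hsq, hsW]
        rw [mul_smul_comm, smul_mul_assoc, ← smul_add]
        have : (star (Z t) - Z t) * (star (Z t) + Z t) + (star (Z t) + Z t) * (star (Z t) - Z t)
          = 2 * (star (Z t) * star (Z t) - Z t * Z t) := by noncomm_ring
        rw [this, hh, sub_self]; simp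
    exact sub_eq_zero.mp h2
  have hSM : Commute (S t) (M t) := (hcS (M t) (Commute.refl _)).symm
  have hSZ : Commute (S t) (Z t) := hcZ _ hSM
  have hsq1 : (S t * Z t) * (S t * Z t) = 1 := by
    rw [hSZ.symm.mul_mul_mul_comm, hsq]
    exact Ring.mul_inverse_cancel _ hunit
  refine ⟨?_, ?_, ?_⟩
  · rw [smul_mul_smul_comm]
    have : (1 + S t * Z t) * (1 + S t * Z t) = (2:ℝ) • (1 + S t * Z t) := by
      rw [mul_add, add_mul, add_mul, hsq1, two_smul]; simp; abel
    rw [this, smul_smul]; norm_num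
  · rw [star_smul, star_add, star_mul, hsS, hsZ, hSZ.eq]; simp
  · intro X hX
    exact ((Commute.one_right X).add_right ((hcS X hX).mul_right (hcZ X hX))).smul_right _

lemma proj_rank {n : ℕ} {P : Matrix (Fin n) (Fin n) ℂ} (hP : P * P = P) (hs : star P = P) :
    ∃ r : ℕ, P.trace = r ∧ ∀ c : ℂ, (1 + (c - 1) • P).det = c ^ r := by
  have hH : P.IsHermitian := hs
  obtain ⟨φ, hφ⟩ : ∃ φ, φ = Unitary.conjStarAlgAut ℂ (Matrix (Fin n) (Fin n) ℂ) hH.eigenvectorUnitary := ⟨_, rfl⟩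
  have hsp := hH.spectral_theorem
  rw [← hφ] at hsp
  have hdiag : ∀ i, ((hH.eigenvalues i : ℝ) : ℂ) = 0 ∨ ((hH.eigenvalues i : ℝ) : ℂ) = 1 := by
    rw [hsp, ← map_mul] at hP
    have h := φ.injective hP
    rw [diagonal_mul_diagonal] at h
    intro i
    have := congrFun (diagonal_injective h) i
    simp only [Function.comp] at this
    change ((hH.eigenvalues i : ℝ) : ℂ) * ((hH.eigenvalues i : ℝ) : ℂ) = ((hH.eigenvalues i : ℝ) : ℂ) at this
    have h3 : ((hH.eigenvalues i : ℝ) : ℂ) * (((hH.eigenvalues i : ℝ) : ℂ) - 1) = 0 := by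
      rw [mul_sub, this]; simp
    rcases mul_eq_zero.mp h3 with h | h
    · exact Or.inl h
    · exact Or.inr (sub_eq_zero.mp h)
  classical
  refine ⟨(Finset.univ.filter fun i => ((hH.eigenvalues i : ℝ) : ℂ) = 1).card, ?_, ?_⟩
  · rw [hH.trace_eq_sum_eigenvalues, Finset.card_eq_sum_ones, Finset.sum_filter]
    push_cast
    apply Finset.sum_congr rfl
    intro i _
    rcases hdiag i with h | h <;> simp [h]
  · intro c
    have hdet : ∀ D, (φ D).det = D.det := by
      intro D
      rw [hφ, Unitary.conjStarAlgAut_apply, det_mul_right_comm]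
      simp
    have : 1 + (c - 1) • P = φ (diagonal fun i => 1 + (c - 1) * ((hH.eigenvalues i : ℝ) : ℂ)) := by
      conv_lhs => rw [hsp]
      rw [← map_one φ, ← map_smul, ← map_add]
      congr 1
      rw [← diagonal_one, ← diagonal_smul, diagonal_add]
      rfl
    rw [this, hdet, det_diagonal, ← Finset.prod_const, Finset.prod_filter]
    apply Finset.prod_congr rfl
    intro i _
    rcases hdiag i with h | h <;> simp [h]

lemma spectral_poly {n : ℕ} {N : Matrix (Fin n) (Fin n) ℂ} (hs : star N = N) (hN : N ≠ 0)
    (htr : N.trace = 0) :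
    ∃ q : ℝ[X], aeval N q * aeval N q = aeval N q ∧ aeval N q ≠ 0 ∧
      ∀ P : Matrix (Fin n) (Fin n) ℂ, N * P = N → aeval N q * P = aeval N q ∧ aeval N q ≠ P := by
  have hH : N.IsHermitian := hs
  obtain ⟨φ, hφ⟩ : ∃ φ, φ = Unitary.conjStarAlgAut ℂ (Matrix (Fin n) (Fin n) ℂ) hH.eigenvectorUnitary := ⟨_, rfl⟩
  have hsp := hH.spectral_theorem
  rw [← hφ] at hsp
  set e := hH.eigenvalues with he
  have htre : ∑ i, e i = 0 := by
    have := hH.trace_eq_sum_eigenvalues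
    rw [htr] at this
    have h2 : ((∑ i, e i : ℝ) : ℂ) = 0 := by rw [this]; push_cast; rfl
    exact_mod_cast h2
  have hex : ∃ i, 0 < e i := by
    by_contra hcon
    push Not at hcon
    have := (Finset.sum_eq_zero_iff_of_nonpos (fun i _ => hcon i)).mp htre
    apply hN
    rw [hsp]
    have : (RCLike.ofReal ∘ e : Fin n → ℂ) = 0 := by
      ext i; simp [this i (Finset.mem_univ i)]
    rw [this]; simp
  have haev : ∀ q : ℝ[X], aeval N q = φ (diagonal fun i => ((q.eval (e i) : ℝ) : ℂ)) := by
    intro q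
    conv_lhs => rw [hsp]
    induction q using Polynomial.induction_on' with
    | add p q hp hq =>
      rw [map_add, hp, hq, ← map_add, diagonal_add]; simp
    | monomial k a =>
      rw [aeval_monomial, ← map_pow, diagonal_pow, ← Algebra.smul_def]
      have : (a • φ (diagonal ((RCLike.ofReal ∘ e : Fin n → ℂ) ^ k))) = (a : ℂ) • φ (diagonal ((RCLike.ofReal ∘ e : Fin n → ℂ) ^ k)) := by
        ext; simp
      rw [this, ← map_smul, ← diagonal_smul]
      congr 2
      ext i
      simp
  obtain ⟨q', hq'⟩ : ∃ q' : ℝ[X], ∀ i, q'.eval (e i) = if 0 < e i then (e i)⁻¹ else 0 := by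
    refine ⟨Lagrange.interpolate (Finset.univ.image e) id (fun x => if 0 < x then x⁻¹ else 0), fun i => ?_⟩
    exact Lagrange.eval_interpolate_at_node (s := Finset.univ.image e) (v := id) (i := e i) _ (Set.injOn_id _) (by simp)
  have hq : ∀ i, (X * q').eval (e i) = if 0 < e i then 1 else 0 := by
    intro i
    rw [eval_mul, eval_X, hq']
    split_ifs with h
    · exact mul_inv_cancel₀ h.ne'
    · simp
  refine ⟨X * q', ?_, ?_, ?_⟩
  · rw [← map_mul, haev, haev]
    congr 3
    ext i
    rw [eval_mul, hq]; split_ifs <;> simp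
  · intro h0
    rw [haev, ← map_zero φ] at h0
    replace h0 := φ.injective h0
    obtain ⟨i, hi⟩ := hex
    have := congrFun (congrFun h0 i) i
    rw [diagonal_apply_eq, hq, if_pos hi] at this
    simp at this
  · intro P hP
    refine ⟨?_, ?_⟩
    · rw [mul_comm, map_mul, aeval_X, mul_assoc, hP]
    · intro h0
      have h1 : N * aeval N (X * q') = N := by rw [h0, hP]
      have h2 : aeval N (X * (X * q')) = aeval N (X : ℝ[X]) := by
        rw [map_mul, aeval_X, h1]
      rw [haev, haev] at h2
      have h3 := diagonal_injective (φ.injective h2)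
      have h4 : ∀ i, 0 ≤ e i := by
        intro i
        have := congrFun h3 i
        simp only [Complex.ofReal_inj] at this
        rw [eval_mul, hq, eval_X] at this
        split_ifs at this with h
        · exact h.le
        · linarith
      have h5 := (Finset.sum_eq_zero_iff_of_nonneg (fun i _ => h4 i)).mp htre
      obtain ⟨i, hi⟩ := hex
      rw [h5 i (Finset.mem_univ i)] at hi
      exact lt_irrefl _ hi

end LocalPart

section LocalPart2
open Filter Topology
open scoped Matrix.Norms.L2Operator ComplexOrder

lemma analytic_trace {n : ℕ} {F : ℝ → Matrix (Fin n) (Fin n) ℂ} {t₀ : ℝ} (hF : AnalyticAt ℝ F t₀) :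
    AnalyticAt ℝ (fun t => (F t).trace) t₀ :=
  ((Matrix.traceLinearMap (Fin n) ℝ ℂ).toContinuousLinearMap.analyticAt _).fun_comp hF

lemma analytic_star {n : ℕ} {F : ℝ → Matrix (Fin n) (Fin n) ℂ} {t₀ : ℝ} (hF : AnalyticAt ℝ F t₀) :
    AnalyticAt ℝ (fun t => star (F t)) t₀ :=
  ((starL' ℝ : Matrix (Fin n) (Fin n) ℂ ≃L[ℝ] Matrix (Fin n) (Fin n) ℂ).toContinuousLinearMap.analyticAt
    (F t₀)).fun_comp hF

lemma proj_rank_eventually {n : ℕ} {P : ℝ → Matrix (Fin n) (Fin n) ℂ} {t₀ : ℝ}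
    (hP : AnalyticAt ℝ P t₀) (hPp : ∀ᶠ t in 𝓝 t₀, P t * P t = P t ∧ star (P t) = P t) :
    ∃ r : ℕ, ∀ᶠ t in 𝓝 t₀, (P t).trace = r ∧ ∀ c : ℂ, (1 + (c - 1) • P t).det = c ^ r := by
  obtain ⟨r, hr, -⟩ := proj_rank hPp.self_of_nhds.1 hPp.self_of_nhds.2
  refine ⟨r, ?_⟩
  have hc : ∀ᶠ t in 𝓝 t₀, dist (P t).trace (P t₀).trace < 1 :=
    Metric.tendsto_nhds.mp (analytic_trace hP).continuousAt.tendsto 1 one_pos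
  filter_upwards [hPp, hc] with t ht hd
  obtain ⟨r', hr', hdet⟩ := proj_rank ht.1 ht.2
  have : r' = r := by
    rw [hr, hr', Complex.dist_eq] at hd
    have h1 : (((r' : ℤ) - (r : ℤ) : ℤ) : ℂ) = (r' : ℂ) - r := by push_cast; rfl
    rw [← h1, Complex.norm_intCast] at hd
    have h2 : |(r' : ℤ) - r| < 1 := by exact_mod_cast hd
    rw [Int.abs_lt_one_iff] at h2
    omega
  subst this
  exact ⟨hr', hdet⟩

lemma proj_trace_zero {n : ℕ} {P : Matrix (Fin n) (Fin n) ℂ} (hP : P * P = P) (hs : star P = P)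
    (h : P.trace = 0) : P = 0 := by
  rw [← Matrix.trace_conjTranspose_mul_self_eq_zero_iff (A := P)]
  change (star P * P).trace = 0
  rw [hs, hP, h]

lemma ext_eq {E : Type*} [TopologicalSpace E] [T2Space E] {f g : ℝ → E} {t₀ : ℝ}
    (hf : ContinuousAt f t₀) (hg : ContinuousAt g t₀) (h : ∀ᶠ t in 𝓝[≠] t₀, f t = g t) :
    ∀ᶠ t in 𝓝 t₀, f t = g t :=
  (ContinuousAt.eventuallyEq_nhds_iff_eventuallyEq_nhdsNE hf hg).mp h

lemma commute_aeval_right {𝔸 : Type*} [Ring 𝔸] [Algebra ℝ 𝔸] {x y : 𝔸} (h : Commute x y) (q : ℝ[X]) :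
    Commute x (aeval y q) := by
  induction q using Polynomial.induction_on' with
  | add p q hp hq => rw [map_add]; exact hp.add_right hq
  | monomial k a =>
    rw [aeval_monomial, ← Algebra.smul_def]
    exact (h.pow_right k).smul_right a

lemma split_projection {n : ℕ} {P H : ℝ → Matrix (Fin n) (Fin n) ℂ} {t₀ : ℝ}
    (hP : AnalyticAt ℝ P t₀) (hPp : ∀ᶠ t in 𝓝 t₀, P t * P t = P t ∧ star (P t) = P t)
    (hH : AnalyticAt ℝ H t₀) (hHs : ∀ᶠ t in 𝓝 t₀, star (H t) = H t)
    (hc : ∀ᶠ t in 𝓝 t₀, Commute (H t) (P t)) :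
    (∃ h : ℝ → ℂ, AnalyticAt ℝ h t₀ ∧ ∀ᶠ t in 𝓝 t₀, H t * P t = h t • P t) ∨
    ∃ Q : ℝ → Matrix (Fin n) (Fin n) ℂ, AnalyticAt ℝ Q t₀ ∧ Q t₀ ≠ 0 ∧ Q t₀ ≠ P t₀ ∧
      (∀ᶠ t in 𝓝 t₀, Q t * Q t = Q t ∧ star (Q t) = Q t ∧ Q t * P t = Q t) ∧
      ∀ᶠ t in 𝓝[≠] t₀, ∀ X, Commute X (H t) → Commute X (P t) → Commute X (Q t) := by
  obtain ⟨r, hr⟩ := proj_rank_eventually hP hPp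
  by_cases hr0 : r = 0
  · left
    refine ⟨fun _ => 0, analyticAt_const, ?_⟩
    filter_upwards [hPp, hr] with t ht hrt
    rw [proj_trace_zero ht.1 ht.2 (by rw [hrt.1, hr0]; simp)]
    simp
  have hrC : (r : ℂ) ≠ 0 := by exact_mod_cast hr0
  let h : ℝ → ℂ := fun t => (H t * P t).trace / r
  have hh : AnalyticAt ℝ h t₀ := (analytic_trace (hH.mul hP)).div_const
  let B : ℝ → Matrix (Fin n) (Fin n) ℂ := fun t => H t * P t - h t • P t
  have hB : AnalyticAt ℝ B t₀ := (hH.mul hP).sub (hh.smul hP)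
  have hBprop : ∀ᶠ t in 𝓝 t₀, star (B t) = B t ∧ B t * P t = B t ∧ P t * B t = B t ∧
      (B t).trace = 0 := by
    filter_upwards [hPp, hHs, hc, hr] with t hPt hHt hct hrt
    have hHP : star (H t * P t) = H t * P t := by
      rw [star_mul, hPt.2, hHt, hct.eq]
    have hhr : star (h t) = h t := by
      simp only [h]
      rw [star_div₀, ← trace_conjTranspose]
      change (star (H t * P t)).trace / star (r : ℂ) = _
      rw [hHP]; simp
    refine ⟨?_, ?_, ?_, ?_⟩
    · simp only [B]; rw [star_sub, star_smul, hHP, hhr, hPt.2]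
    · simp only [B]; rw [sub_mul, smul_mul_assoc, mul_assoc, hPt.1]
    · simp only [B]; rw [mul_sub, mul_smul_comm, hPt.1, hct.eq, ← mul_assoc, hPt.1]
    · simp only [B, h]
      rw [trace_sub, trace_smul, hrt.1, smul_eq_mul, div_mul_cancel₀ _ hrC, sub_self]
  by_cases hB0 : ∀ᶠ t in 𝓝 t₀, B t = 0
  · left
    exact ⟨h, hh, hB0.mono fun t ht => sub_eq_zero.mp ht⟩
  right
  obtain ⟨m, G, hG, hG0, hBG⟩ := hB.exists_eventuallyEq_pow_smul_nonzero_iff.mpr hB0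
  have hGB : ∀ᶠ t in 𝓝[≠] t₀, G t = ((t - t₀) ^ m)⁻¹ • B t := by
    filter_upwards [hBG.filter_mono nhdsWithin_le_nhds, self_mem_nhdsWithin] with t ht hne
    have : (t - t₀) ^ m ≠ 0 := pow_ne_zero _ (sub_ne_zero.mpr hne)
    rw [ht, smul_smul, inv_mul_cancel₀ this, one_smul]
  have hBn := hBprop.filter_mono (nhdsWithin_le_nhds (s := {t₀}ᶜ))
  have hGs : ∀ᶠ t in 𝓝 t₀, star (G t) = G t := by
    refine ext_eq (analytic_star hG).continuousAt hG.continuousAt ?_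
    filter_upwards [hGB, hBn] with t h1 h2
    rw [h1, star_smul, h2.1]; simp
  have hGP : ∀ᶠ t in 𝓝 t₀, G t * P t = G t := by
    refine ext_eq (hG.mul hP).continuousAt hG.continuousAt ?_
    filter_upwards [hGB, hBn] with t h1 h2
    rw [h1, smul_mul_assoc, h2.2.1]
  have hPG : ∀ᶠ t in 𝓝 t₀, P t * G t = G t := by
    refine ext_eq (hP.mul hG).continuousAt hG.continuousAt ?_
    filter_upwards [hGB, hBn] with t h1 h2
    rw [h1, mul_smul_comm, h2.2.2.1]
  have hGt : ∀ᶠ t in 𝓝 t₀, (G t).trace = 0 := by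
    refine ext_eq (analytic_trace hG).continuousAt continuousAt_const ?_
    filter_upwards [hGB, hBn] with t h1 h2
    rw [h1, trace_smul, h2.2.2.2, smul_zero]
  obtain ⟨q, hq1, hq2, hq3⟩ := spectral_poly hGs.self_of_nhds hG0 hGt.self_of_nhds
  obtain ⟨hq3, hq4⟩ := hq3 _ hGP.self_of_nhds
  have hcM : ∀ (t : ℝ) (X : Matrix (Fin n) (Fin n) ℂ), Commute X (G t) → Commute X (aeval (G t) q) :=
    fun t X hX => commute_aeval_right hX q
  obtain ⟨e, he, he0, hev⟩ := refine_idempotent (M := fun t => aeval (G t) q) (hG.aeval_polynomial q)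
    (hGs.mono fun t ht => isSelfAdjoint_aeval_real ht q) hq1
  have hePc : ∀ᶠ t in 𝓝 t₀, Commute (P t) (e t) := by
    filter_upwards [hev, hGP, hPG] with t h1 h2 h3
    exact h1.2.2 _ (hcM t _ (h3.trans h2.symm))
  have hQ0 : e t₀ * P t₀ = aeval (G t₀) q := by rw [he0]; exact hq3
  refine ⟨fun t => e t * P t, he.mul hP, ?_, ?_, ?_, ?_⟩
  · simp only [hQ0]; exact hq2
  · simp only [hQ0]; exact hq4
  · filter_upwards [hev, hePc, hPp] with t h1 h2 h3
    refine ⟨?_, ?_, ?_⟩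
    · rw [h2.mul_mul_mul_comm, h1.1, h3.1]
    · rw [star_mul, h1.2.1, h3.2, h2.eq]
    · rw [mul_assoc, h3.1]
  · filter_upwards [hev.filter_mono nhdsWithin_le_nhds, hGB] with t h1 h2 X hXH hXP
    refine (h1.2.2 X (hcM t X ?_)).mul_right hXP
    rw [h2]
    exact ((hXH.mul_right hXP).sub_right (hXP.smul_right _)).smul_right _

lemma local_factor {n : ℕ} {H K : ℝ → Matrix (Fin n) (Fin n) ℂ} {t₀ : ℝ}
    (hH : AnalyticAt ℝ H t₀) (hHs : ∀ᶠ t in 𝓝 t₀, star (H t) = H t)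
    (hK : AnalyticAt ℝ K t₀) (hKs : ∀ᶠ t in 𝓝 t₀, star (K t) = K t)
    (hHK : ∀ᶠ t in 𝓝 t₀, Commute (H t) (K t)) (r : ℕ) :
    ∀ P : ℝ → Matrix (Fin n) (Fin n) ℂ, AnalyticAt ℝ P t₀ →
      (∀ᶠ t in 𝓝 t₀, P t * P t = P t ∧ star (P t) = P t) →
      (∀ᶠ t in 𝓝 t₀, Commute (H t) (P t)) → (∀ᶠ t in 𝓝 t₀, Commute (K t) (P t)) →
      (P t₀).trace = r →
      ∃ L : List (ℝ → ℂ), (∀ l ∈ L, AnalyticAt ℝ l t₀) ∧ ∀ᶠ t in 𝓝 t₀, ∀ x : ℂ,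
        (1 + (x • 1 - (H t + Complex.I • K t) - 1) * P t).det = (L.map fun l => x - l t).prod := by
  induction r using Nat.strong_induction_on with
  | _ r ih =>
  intro P hP hPp hHP hKP htr
  have key : ∀ Q : ℝ → Matrix (Fin n) (Fin n) ℂ, AnalyticAt ℝ Q t₀ → Q t₀ ≠ 0 → Q t₀ ≠ P t₀ →
      (∀ᶠ t in 𝓝 t₀, Q t * Q t = Q t ∧ star (Q t) = Q t ∧ Q t * P t = Q t) →
      (∀ᶠ t in 𝓝[≠] t₀, Commute (H t) (Q t)) → (∀ᶠ t in 𝓝[≠] t₀, Commute (K t) (Q t)) →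
      ∃ L : List (ℝ → ℂ), (∀ l ∈ L, AnalyticAt ℝ l t₀) ∧ ∀ᶠ t in 𝓝 t₀, ∀ x : ℂ,
        (1 + (x • 1 - (H t + Complex.I • K t) - 1) * P t).det = (L.map fun l => x - l t).prod := by
    intro Q hQ hQ0 hQP hQp hHQ hKQ
    replace hHQ : ∀ᶠ t in 𝓝 t₀, H t * Q t = Q t * H t :=
      ext_eq (hH.mul hQ).continuousAt (hQ.mul hH).continuousAt hHQ
    replace hKQ : ∀ᶠ t in 𝓝 t₀, K t * Q t = Q t * K t :=
      ext_eq (hK.mul hQ).continuousAt (hQ.mul hK).continuousAt hKQ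
    have hPQ : ∀ᶠ t in 𝓝 t₀, P t * Q t = Q t := by
      filter_upwards [hQp, hPp] with t h1 h2
      have := congrArg star h1.2.2
      rwa [star_mul, h1.2.1, h2.2] at this
    have hRp : ∀ᶠ t in 𝓝 t₀, (P t - Q t) * (P t - Q t) = P t - Q t ∧ star (P t - Q t) = P t - Q t := by
      filter_upwards [hQp, hPp, hPQ] with t h1 h2 h3
      refine ⟨?_, by rw [star_sub, h1.2.1, h2.2]⟩
      rw [mul_sub, sub_mul, sub_mul, h2.1, h1.2.2, h3, h1.1, sub_self, sub_zero]
    obtain ⟨a, ha, -⟩ := proj_rank hQp.self_of_nhds.1 hQp.self_of_nhds.2.1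
    obtain ⟨b, hb, -⟩ := proj_rank hRp.self_of_nhds.1 hRp.self_of_nhds.2
    have hab : a + b = r := by
      rw [trace_sub, htr, ha] at hb
      have : ((a + b : ℕ) : ℂ) = r := by push_cast; rw [← hb]; ring
      exact_mod_cast this
    have ha0 : a ≠ 0 := by
      rintro rfl
      exact hQ0 (proj_trace_zero hQp.self_of_nhds.1 hQp.self_of_nhds.2.1 (by simpa using ha))
    have hb0 : b ≠ 0 := by
      rintro rfl
      have := proj_trace_zero hRp.self_of_nhds.1 hRp.self_of_nhds.2 (by simpa using hb)
      exact hQP (sub_eq_zero.mp this).symm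
    obtain ⟨L1, hL1, hd1⟩ := ih a (by omega) Q hQ (hQp.mono fun t h => ⟨h.1, h.2.1⟩) hHQ hKQ ha
    obtain ⟨L2, hL2, hd2⟩ := ih b (by omega) (fun t => P t - Q t) (hP.sub hQ) hRp
      (by filter_upwards [hHQ, hHP] with t h1 h2 using h2.sub_right h1)
      (by filter_upwards [hKQ, hKP] with t h1 h2 using h2.sub_right h1) hb
    refine ⟨L1 ++ L2, ?_, ?_⟩
    · intro l hl
      rcases List.mem_append.mp hl with h | h
      · exact hL1 l h
      · exact hL2 l h
    · filter_upwards [hd1, hd2, hQp, hHQ, hKQ, hPQ] with t h1 h2 h3 h4 h5 h6 x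
      rw [List.map_append, List.prod_append, ← h1, ← h2, ← det_mul]
      congr 1
      set Y := x • (1 : Matrix (Fin n) (Fin n) ℂ) - (H t + Complex.I • K t) - 1 with hY
      have hYQ : Commute Y (Q t) := by
        have e1 : Commute (H t) (Q t) := h4
        have e2 : Commute (K t) (Q t) := h5
        exact ((((Commute.one_left _).smul_left x).sub_left (e1.add_left (e2.smul_left _))).sub_left
          (Commute.one_left _))
      have hz : Y * Q t * (Y * (P t - Q t)) = 0 := by
        have : Q t * (P t - Q t) = 0 := by rw [mul_sub, h3.2.2, h3.1, sub_self]
        rw [mul_assoc Y, ← mul_assoc (Q t) Y, ← hYQ.eq, mul_assoc Y (Q t), this]; simp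
      rw [mul_add, mul_one, add_mul, one_mul, hz, add_zero, mul_sub]
      abel
  rcases split_projection hP hPp hH hHs hHP with ⟨h, hh, hhe⟩ | ⟨Q, hQ, hQ0, hQP, hQp, hQc⟩
  swap
  · refine key Q hQ hQ0 hQP hQp ?_ ?_
    · filter_upwards [hQc, hHP.filter_mono nhdsWithin_le_nhds] with t h1 h2
      exact h1 _ (Commute.refl _) h2
    · filter_upwards [hQc, hKP.filter_mono nhdsWithin_le_nhds, hHK.filter_mono nhdsWithin_le_nhds] with t h1 h2 h3
      exact h1 _ h3.symm h2
  rcases split_projection hP hPp hK hKs hKP with ⟨k, hk, hke⟩ | ⟨Q, hQ, hQ0, hQP, hQp, hQc⟩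
  swap
  · refine key Q hQ hQ0 hQP hQp ?_ ?_
    · filter_upwards [hQc, hHP.filter_mono nhdsWithin_le_nhds, hHK.filter_mono nhdsWithin_le_nhds] with t h1 h2 h3
      exact h1 _ h3 h2
    · filter_upwards [hQc, hKP.filter_mono nhdsWithin_le_nhds] with t h1 h2
      exact h1 _ (Commute.refl _) h2
  obtain ⟨m, hm⟩ := proj_rank_eventually hP hPp
  refine ⟨List.replicate m (fun t => h t + Complex.I * k t), ?_, ?_⟩
  · intro l hl
    rw [List.eq_of_mem_replicate hl]
    exact hh.add (analyticAt_const.mul hk)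
  · filter_upwards [hhe, hke, hm] with t h1 h2 h3 x
    rw [List.map_replicate, List.prod_replicate, ← h3.2]
    congr 2
    rw [sub_mul, sub_mul, add_mul, smul_mul_assoc, smul_mul_assoc, h1, h2, one_mul, smul_smul,
      ← add_smul, ← sub_smul, sub_smul _ (1:ℂ), one_smul]

lemma local_param {n : ℕ} {A : ℝ → Matrix (Fin n) (Fin n) ℂ} (t₀ : ℝ)
    (hA : ∀ i j : Fin n, ∀ t : ℝ, AnalyticAt ℝ (fun s => A s i j) t)
    (hnormal : ∀ t : ℝ, A t * (A t)ᴴ = (A t)ᴴ * A t) :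
    ∃ l : Fin n → ℝ → ℂ, (∀ j, AnalyticAt ℝ (l j) t₀) ∧
      ∀ᶠ t in 𝓝 t₀, ((A t).charpoly).roots = Finset.univ.val.map (fun j => l j t) := by
  have hAm : AnalyticAt ℝ A t₀ := by
    have : A = fun t => ∑ i, ∑ j, (A t i j) • Matrix.single i j (1 : ℂ) := by
      ext1 t
      conv_lhs => rw [matrix_eq_sum_single (A t)]
      simp
    rw [this]
    refine Finset.analyticAt_fun_sum _ fun i _ => Finset.analyticAt_fun_sum _ fun j _ => ?_
    exact (hA i j t₀).smul analyticAt_const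
  have hAs := analytic_star hAm
  let H : ℝ → Matrix (Fin n) (Fin n) ℂ := fun t => (1/2 : ℂ) • (A t + star (A t))
  let K : ℝ → Matrix (Fin n) (Fin n) ℂ := fun t => (-Complex.I/2 : ℂ) • (A t - star (A t))
  have hc : ∀ t, Commute (A t) (star (A t)) := hnormal
  have hH : AnalyticAt ℝ H t₀ := analyticAt_const.fun_smul (hAm.fun_add hAs)
  have hK : AnalyticAt ℝ K t₀ := analyticAt_const.fun_smul (hAm.fun_sub hAs)
  have hsum : ∀ t, H t + Complex.I • K t = A t := by
    intro t
    ext i j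
    simp only [H, K, Matrix.add_apply, Matrix.smul_apply, Matrix.sub_apply, smul_eq_mul]
    linear_combination (-(A t i j - star (A t) i j) / 2) * Complex.I_mul_I
  obtain ⟨L, hL, hd⟩ := local_factor (t₀ := t₀) hH (.of_forall fun t => by
      simp only [H, star_smul, star_add, star_star]
      rw [add_comm]; simp) hK (.of_forall fun t => by
      simp only [K, star_smul, star_sub, star_star]
      rw [← neg_sub (A t), smul_neg, ← neg_smul]; congr 1; simp [neg_div]) (.of_forall fun t => by
      refine Commute.smul_left (Commute.smul_right ?_ _) _
      exact Commute.add_left ((Commute.refl _).sub_right (hc t))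
        ((hc t).symm.sub_right (Commute.refl _))) n (fun _ => 1) analyticAt_const
      (.of_forall fun t => by simp) (.of_forall fun t => Commute.one_right _)
      (.of_forall fun t => Commute.one_right _) (by simp)
  have hroots : ∀ᶠ t in 𝓝 t₀, ((A t).charpoly).roots = ((L.map fun l => l t : List ℂ) : Multiset ℂ) := by
    filter_upwards [hd] with t ht
    have : (A t).charpoly = (((L.map fun l => l t : List ℂ) : Multiset ℂ).map fun a => X - C a).prod := by
      apply Polynomial.funext
      intro x
      rw [Matrix.eval_charpoly]
      have := ht x
      rw [hsum, mul_one, add_sub_cancel] at this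
      rw [Matrix.scalar_apply, ← smul_one_eq_diagonal, this, Polynomial.eval_multiset_prod]
      simp [Function.comp_def]
    rw [this, roots_multiset_prod_X_sub_C]
  have hlen : L.length = n := by
    have h1 := hroots.self_of_nhds
    have h2 := congrArg Multiset.card h1
    rw [IsAlgClosed.card_roots_eq_natDegree, charpoly_natDegree_eq_dim] at h2
    simpa using h2.symm
  subst hlen
  refine ⟨fun j => L.get j, fun j => hL _ (List.get_mem _ _), ?_⟩
  filter_upwards [hroots] with t ht
  rw [ht, Fin.univ_val_map]
  congr 1
  apply List.ext_getElem <;> simp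

end LocalPart2

section GlobalPart
open Filter Topology Set

lemma exists_perm_of_map_eq {n : ℕ} {α : Type*} (f g : Fin n → α)
    (h : (Finset.univ : Finset (Fin n)).val.map f = (Finset.univ : Finset (Fin n)).val.map g) :
    ∃ σ : Equiv.Perm (Fin n), ∀ j, f j = g (σ j) := by
  classical
  have hcard : ∀ a, Fintype.card {i // f i = a} = Fintype.card {i // g i = a} := by
    intro a
    have := congrArg (Multiset.count a) h
    rw [Multiset.count_map, Multiset.count_map] at this
    rw [Fintype.card_subtype, Fintype.card_subtype]
    simp only [eq_comm (a := a)] at this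
    exact this
  let e : ∀ a, {i // f i = a} ≃ {i // g i = a} := fun a => Fintype.equivOfCardEq (hcard a)
  refine ⟨(Equiv.sigmaFiberEquiv f).symm.trans ((Equiv.sigmaCongrRight e).trans
    (Equiv.sigmaFiberEquiv g)), fun j => ?_⟩
  exact (e (f j) ⟨j, rfl⟩).2.symm

/-- The functions `l` parameterize the multisets `R t` analytically on `U`. -/
def IsParam {n : ℕ} (R : ℝ → Multiset ℂ) (l : Fin n → ℝ → ℂ) (U : Set ℝ) : Prop :=
  (∀ j, AnalyticOnNhd ℝ (l j) U) ∧
    ∀ t ∈ U, R t = (Finset.univ : Finset (Fin n)).val.map (fun j => l j t)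

lemma IsParam.mono {n : ℕ} {R : ℝ → Multiset ℂ} {l : Fin n → ℝ → ℂ} {U V : Set ℝ}
    (h : IsParam R l U) (hVU : V ⊆ U) : IsParam R l V :=
  ⟨fun j => (h.1 j).mono hVU, fun t ht => h.2 t (hVU ht)⟩

lemma map_perm_eq {n : ℕ} (σ : Equiv.Perm (Fin n)) (f : Fin n → ℂ) :
    (Finset.univ : Finset (Fin n)).val.map (fun j => f (σ j)) =
      (Finset.univ : Finset (Fin n)).val.map f := by
  conv_rhs => rw [← Multiset.map_univ_val_equiv σ, Multiset.map_map]
  rfl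

lemma IsParam.perm {n : ℕ} {R : ℝ → Multiset ℂ} {l : Fin n → ℝ → ℂ} {U : Set ℝ}
    (h : IsParam R l U) (σ : Equiv.Perm (Fin n)) : IsParam R (fun j => l (σ j)) U :=
  ⟨fun j => h.1 (σ j), fun t ht => by rw [h.2 t ht, map_perm_eq σ (fun j => l j t)]⟩

lemma IsParam.exists_perm {n : ℕ} {R : ℝ → Multiset ℂ} {l m : Fin n → ℝ → ℂ} {U : Set ℝ}
    (hl : IsParam R l U) (hm : IsParam R m U) (hU : IsOpen U) (hc : IsPreconnected U)
    {x : ℝ} (hx : x ∈ U) : ∃ σ : Equiv.Perm (Fin n), ∀ j, EqOn (l j) (m (σ j)) U := by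
  have hev : ∀ᶠ t in 𝓝[≠] x, ∃ σ : Equiv.Perm (Fin n), ∀ j, l j t = m (σ j) t := by
    filter_upwards [(hU.mem_nhds hx : U ∈ 𝓝 x) |> mem_nhdsWithin_of_mem_nhds] with t ht
    exact exists_perm_of_map_eq (fun j => l j t) (fun j => m j t) ((hl.2 t ht).symm.trans (hm.2 t ht))
  obtain ⟨σ, hσ⟩ := frequently_exists.mp hev.frequently
  refine ⟨σ, fun j => ?_⟩
  exact (hl.1 j).eqOn_of_preconnected_of_frequently_eq (hm.1 (σ j)) hc hx (hσ.mono fun t ht => ht j)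

/-- Existence of a parameterization on a neighbourhood of `[a, b]`. -/
def GoodParam (n : ℕ) (R : ℝ → Multiset ℂ) (a b : ℝ) : Prop :=
  ∃ a' b' : ℝ, a' < a ∧ b < b' ∧ ∃ l : Fin n → ℝ → ℂ, IsParam R l (Ioo a' b')

lemma GoodParam.trans {n : ℕ} {R : ℝ → Multiset ℂ} {a x y : ℝ} (hax : a ≤ x) (hxy : x ≤ y)
    (h1 : GoodParam n R a x) (h2 : GoodParam n R x y) : GoodParam n R a y := by
  obtain ⟨a', b', ha', hb', l, hl⟩ := h1
  obtain ⟨c, d, hc, hd, m, hm⟩ := h2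
  obtain ⟨σ, hσ⟩ := (hl.mono (V := Ioo (max a' c) (min b' d))
      (Ioo_subset_Ioo (le_max_left _ _) (min_le_left _ _))).exists_perm
    (hm.mono (Ioo_subset_Ioo (le_max_right _ _) (min_le_right _ _))) isOpen_Ioo isPreconnected_Ioo
    (x := x) ⟨max_lt (ha'.trans_le hax) hc, lt_min hb' (hxy.trans_lt hd)⟩
  have hmσ := hm.perm σ
  refine ⟨a', d, ha', hd, fun j t => if t ≤ x then l j t else m (σ j) t, fun j t ht => ?_, fun t ht => ?_⟩
  · by_cases htx : t ≤ x
    · refine (hl.1 j t ⟨ht.1, htx.trans_lt hb'⟩).congr ?_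
      filter_upwards [Ioo_mem_nhds (a := a') (b := min b' d) ht.1
        (lt_min (htx.trans_lt hb') ht.2)] with s hs
      split_ifs with h
      · rfl
      · push Not at h
        exact hσ j ⟨max_lt hs.1 (hc.trans h), hs.2⟩
    · push Not at htx
      refine (hmσ.1 j t ⟨hc.trans htx, ht.2⟩).congr ?_
      filter_upwards [Ioi_mem_nhds htx] with s hs
      rw [if_neg (not_le.mpr hs)]
  · by_cases htx : t ≤ x
    · simp only [if_pos htx]
      exact hl.2 t ⟨ht.1, htx.trans_lt hb'⟩
    · simp only [if_neg htx]
      exact hmσ.2 t ⟨hc.trans (not_le.mp htx), ht.2⟩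

lemma goodParam_all {n : ℕ} {R : ℝ → Multiset ℂ}
    (hloc : ∀ x, ∃ l : Fin n → ℝ → ℂ, ∃ a b : ℝ, a < x ∧ x < b ∧ IsParam R l (Ioo a b))
    {a b : ℝ} (hab : a ≤ b) : GoodParam n R a b := by
  choose l u v hu hv hl using hloc
  obtain ⟨t, ht0, htm, ⟨m, hm⟩, ht⟩ := exists_monotone_Icc_subset_open_cover_Icc hab
    (c := fun x : ℝ => {s : Icc a b | (s : ℝ) ∈ Ioo (u x) (v x)})
    (fun x => isOpen_Ioo.preimage continuous_subtype_val)
    (fun s _ => mem_iUnion.mpr ⟨s, hu s, hv s⟩)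
  have hind : ∀ k, GoodParam n R a (t k) := by
    intro k
    induction k with
    | zero => rw [ht0]; exact ⟨u a, v a, hu a, hv a, l a, hl a⟩
    | succ k ih =>
      refine ih.trans (t k).2.1 (htm k.le_succ) ?_
      obtain ⟨x, hx⟩ := ht k
      have h1 := hx (left_mem_Icc.mpr (htm k.le_succ))
      have h2 := hx (right_mem_Icc.mpr (htm k.le_succ))
      exact ⟨u x, v x, h1.1, h2.2, l x, hl x⟩
  have := hind m
  rwa [hm m le_rfl] at this

lemma global_param {n : ℕ} {R : ℝ → Multiset ℂ}
    (hloc : ∀ x, ∃ l : Fin n → ℝ → ℂ, ∃ a b : ℝ, a < x ∧ x < b ∧ IsParam R l (Ioo a b)) :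
    ∃ l : Fin n → ℝ → ℂ, IsParam R l univ := by
  have h1 : ∀ N : ℕ, ∃ l : Fin n → ℝ → ℂ, IsParam R l (Ioo (-(N + 1 : ℝ)) (N + 1)) := by
    intro N
    obtain ⟨a', b', ha, hb, l, hl⟩ := goodParam_all hloc (a := -(N + 1 : ℝ)) (b := N + 1)
      (by have : (0 : ℝ) ≤ N := Nat.cast_nonneg N
          linarith)
    exact ⟨l, hl.mono (Ioo_subset_Ioo ha.le hb.le)⟩
  choose l hl using h1
  have hsub : ∀ {N K : ℕ}, N ≤ K → Ioo (-(N + 1 : ℝ)) (N + 1) ⊆ Ioo (-(K + 1 : ℝ)) (K + 1) := by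
    intro N K h
    have : (N : ℝ) ≤ K := by exact_mod_cast h
    exact Ioo_subset_Ioo (by linarith) (by linarith)
  have hzero : ∀ N : ℕ, (0 : ℝ) ∈ Ioo (-(N + 1 : ℝ)) (N + 1) := by
    intro N
    have : (0 : ℝ) ≤ N := Nat.cast_nonneg N
    constructor <;> linarith
  have h2 : ∀ N : ℕ, ∃ σ : Equiv.Perm (Fin n), ∀ j,
      EqOn (l 0 j) (l N (σ j)) (Ioo (-((0 : ℕ) + 1 : ℝ)) ((0 : ℕ) + 1)) := fun N =>
    (hl 0).exists_perm ((hl N).mono (hsub (Nat.zero_le N))) isOpen_Ioo isPreconnected_Ioo (hzero 0)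
  choose σ hσ using h2
  let m : ℕ → Fin n → ℝ → ℂ := fun N j => l N (σ N j)
  have hm : ∀ N, IsParam R (m N) (Ioo (-(N + 1 : ℝ)) (N + 1)) := fun N => (hl N).perm (σ N)
  have hagree : ∀ {N K : ℕ}, N ≤ K → ∀ j, EqOn (m N j) (m K j) (Ioo (-(N + 1 : ℝ)) (N + 1)) := by
    intro N K h j
    refine ((hm N).1 j).eqOn_of_preconnected_of_eventuallyEq (((hm K).mono (hsub h)).1 j)
      isPreconnected_Ioo (hzero N) ?_
    filter_upwards [isOpen_Ioo.mem_nhds (hzero 0)] with s hs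
    exact ((hσ N j) hs).symm.trans ((hσ K j) hs)
  have hagree' : ∀ (N K : ℕ) (j : Fin n) (s : ℝ), s ∈ Ioo (-(N + 1 : ℝ)) (N + 1) →
      s ∈ Ioo (-(K + 1 : ℝ)) (K + 1) → m N j s = m K j s := by
    intro N K j s h1 h2
    rcases le_total N K with h | h
    · exact hagree h j h1
    · exact (hagree h j h2).symm
  have hmem : ∀ s : ℝ, s ∈ Ioo (-((⌈|s|⌉₊ : ℕ) + 1 : ℝ)) ((⌈|s|⌉₊ : ℕ) + 1) := by
    intro s
    have h1 := Nat.le_ceil |s|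
    have h2 := abs_le.mp h1
    constructor <;> linarith [h2.1, h2.2]
  refine ⟨fun j t => m ⌈|t|⌉₊ j t, fun j t _ => ?_, fun t _ => (hm ⌈|t|⌉₊).2 t (hmem t)⟩
  refine ((hm ⌈|t|⌉₊).1 j t (hmem t)).congr ?_
  filter_upwards [isOpen_Ioo.mem_nhds (hmem t)] with s hs
  exact hagree' _ _ j s hs (hmem s)

lemma local_isParam {n : ℕ} {A : ℝ → Matrix (Fin n) (Fin n) ℂ}
    (hA : ∀ i j : Fin n, ∀ t : ℝ, AnalyticAt ℝ (fun s => A s i j) t)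
    (hnormal : ∀ t : ℝ, A t * (A t)ᴴ = (A t)ᴴ * A t) (x : ℝ) :
    ∃ l : Fin n → ℝ → ℂ, ∃ a b : ℝ, a < x ∧ x < b ∧
      IsParam (fun t => (A t).charpoly.roots) l (Ioo a b) := by
  obtain ⟨l, hl, hr⟩ := local_param x hA hnormal
  have h1 : ∀ᶠ t in 𝓝 x, ∀ j, AnalyticAt ℝ (l j) t :=
    eventually_all.mpr fun j => (hl j).eventually_analyticAt
  obtain ⟨a, b, hx, hab⟩ := mem_nhds_iff_exists_Ioo_subset.mp (h1.and hr)
  exact ⟨l, a, b, hx.1, hx.2, fun j t ht => (hab ht).1 j, fun t ht => (hab ht).2⟩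

end GlobalPart

/-- Global real-analytic eigenvalues of real-analytic curves of normal matrices: if
`A : ℝ → M_n(ℂ)` has real-analytic entries and `A t` is normal for every `t`, then there
are real-analytic functions `λ_1, …, λ_n : ℝ → ℂ` such that for every `t` the multiset
`{λ_1 t, …, λ_n t}` is the multiset of roots (with multiplicity) of the characteristic
polynomial of `A t`. -/
theorem analytic_eigenvalues_of_analytic_normal_curve (n : ℕ)
    (A : ℝ → Matrix (Fin n) (Fin n) ℂ)
    (hA : ∀ i j : Fin n, ∀ t : ℝ, AnalyticAt ℝ (fun s => A s i j) t)
    (hnormal : ∀ t : ℝ, A t * (A t)ᴴ = (A t)ᴴ * A t) :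
    ∃ l : Fin n → ℝ → ℂ, (∀ j, ∀ t : ℝ, AnalyticAt ℝ (l j) t) ∧
      ∀ t : ℝ, ((A t).charpoly).roots = Finset.univ.val.map (fun j => l j t) := by
  obtain ⟨l, h1, h2⟩ := global_param (local_isParam hA hnormal)
  exact ⟨l, fun j t => h1 j t (Set.mem_univ t), fun t => h2 t (Set.mem_univ t)⟩
end
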